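/- Let G be an almost torsion-free word-hyperbolic group such that every l-generated subgroup of G is quasiconvex, where l ≥ 1 is an integer. Then G has only finitely many conjugacy classes of freely indecomposable non-elementary (l+1)-generated subgroups; that is, there exist finitely many subgroups H₁,…,H_N of G such that every freely indecomposable, non-elementary subgroup of G generated by at most l+1 elements is conjugate in G to some H_i. -/

import Mathlib

noncomputable section

namespace KW

open Metric Set Pointwise

variable {X : Type*} [MetricSpace X]

/-- `s` is (the image of) a unit-speed geodesic segment joining `x` to `y`. -/
def IsGeodesicSegment (s : Set X) (x y : X) : Prop :=
  ∃ (b : ℝ) (f : ℝ → X), 0 ≤ b ∧ f 0 = x ∧ f b = y ∧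
    (∀ u ∈ Set.Icc (0 : ℝ) b, ∀ v ∈ Set.Icc (0 : ℝ) b, dist (f u) (f v) = |u - v|) ∧
    s = f '' Set.Icc 0 b

/-- A geodesic metric space. -/
def GeodesicSpace (X : Type*) [MetricSpace X] : Prop :=
  ∀ x y : X, ∃ s : Set X, IsGeodesicSegment s x y

/-- `X` is `δ`-hyperbolic: geodesic, and every geodesic triangle is `δ`-thin. -/
def DeltaHyperbolic (δ : ℝ) (X : Type*) [MetricSpace X] : Prop :=
  GeodesicSpace X ∧
    ∀ (x y z : X) (s₁ s₂ s₃ : Set X),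
      IsGeodesicSegment s₁ x y → IsGeodesicSegment s₂ y z → IsGeodesicSegment s₃ x z →
      ∀ p ∈ s₁, ∃ q ∈ s₂ ∪ s₃, dist p q ≤ δ

/-- `A` is an `ε`-quasiconvex subset of `X`. -/
def Quasiconvex (ε : ℝ) (A : Set X) : Prop :=
  ∀ x ∈ A, ∀ y ∈ A, ∀ s : Set X, IsGeodesicSegment s x y → ∀ p ∈ s, ∃ a ∈ A, dist p a ≤ ε

/-- The Gromov product `(y,z)_x`. -/
def gromov (x y z : X) : ℝ := (dist y x + dist z x - dist y z) / 2

def IsGeodesicRay (γ : ℝ → X) : Prop :=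
  ∀ s t : ℝ, 0 ≤ s → 0 ≤ t → dist (γ s) (γ t) = |s - t|

def IsBiGeodesic (γ : ℝ → X) : Prop :=
  ∀ s t : ℝ, dist (γ s) (γ t) = |s - t|

/-- `A` and `B` are `K`-Hausdorff close. -/
def HClose (K : ℝ) (A B : Set X) : Prop :=
  (∀ a ∈ A, ∃ b ∈ B, dist a b ≤ K) ∧ ∀ b ∈ B, ∃ a ∈ A, dist a b ≤ K

def HausdorffClose (A B : Set X) : Prop := ∃ K : ℝ, HClose K A B

/-- Two geodesic rays are asymptotic iff their images are Hausdorff close. -/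
def Asymptotic (γ γ' : ℝ → X) : Prop :=
  HausdorffClose (γ '' Set.Ici 0) (γ' '' Set.Ici 0)

def GRay (X : Type*) [MetricSpace X] : Type _ := {γ : ℝ → X // IsGeodesicRay γ}

theorem asymptotic_refl (γ : ℝ → X) : Asymptotic γ γ :=
  ⟨0, fun a ha => ⟨a, ha, by simp⟩, fun b hb => ⟨b, hb, by simp⟩⟩

theorem asymptotic_symm {γ γ' : ℝ → X} (h : Asymptotic γ γ') : Asymptotic γ' γ := by
  obtain ⟨K, h₁, h₂⟩ := h
  refine ⟨K, fun a ha => ?_, fun b hb => ?_⟩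
  · obtain ⟨b, hb, hd⟩ := h₂ a ha
    exact ⟨b, hb, by rwa [dist_comm]⟩
  · obtain ⟨a, ha, hd⟩ := h₁ b hb
    exact ⟨a, ha, by rwa [dist_comm]⟩

theorem asymptotic_trans {γ₁ γ₂ γ₃ : ℝ → X} (h : Asymptotic γ₁ γ₂)
    (h' : Asymptotic γ₂ γ₃) : Asymptotic γ₁ γ₃ := by
  obtain ⟨K, h₁, h₂⟩ := h
  obtain ⟨K', h₁', h₂'⟩ := h'
  refine ⟨K + K', fun a ha => ?_, fun c hc => ?_⟩
  · obtain ⟨b, hb, hab⟩ := h₁ a ha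
    obtain ⟨c, hc, hbc⟩ := h₁' b hb
    exact ⟨c, hc, (dist_triangle a b c).trans (by linarith)⟩
  · obtain ⟨b, hb, hbc⟩ := h₂' c hc
    obtain ⟨a, ha, hab⟩ := h₂ b hb
    exact ⟨a, ha, (dist_triangle a b c).trans (by linarith)⟩

def raySetoid (X : Type*) [MetricSpace X] : Setoid (GRay X) where
  r γ γ' := Asymptotic γ.1 γ'.1
  iseqv := ⟨fun γ => asymptotic_refl γ.1, fun h => asymptotic_symm h,
    fun h h' => asymptotic_trans h h'⟩

/-- The (geodesic) boundary of `X`: asymptoty classes of geodesic rays. -/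
def Boundary (X : Type*) [MetricSpace X] : Type _ := Quotient (raySetoid X)

def Boundary.mk {X : Type*} [MetricSpace X] (γ : GRay X) : Boundary X :=
  Quotient.mk (raySetoid X) γ

/-- A strongly geodesic metric space. -/
def StronglyGeodesic (X : Type*) [MetricSpace X] : Prop :=
  GeodesicSpace X ∧
  (∀ γ : ℝ → X, IsGeodesicRay γ → ∀ y : X,
      ∃ γ' : ℝ → X, IsGeodesicRay γ' ∧ γ' 0 = y ∧ Asymptotic γ γ') ∧
  (∀ γ₁ γ₂ : ℝ → X, IsGeodesicRay γ₁ → IsGeodesicRay γ₂ → γ₁ 0 = γ₂ 0 →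
      ¬ Asymptotic γ₁ γ₂ →
      ∃ γ : ℝ → X, IsBiGeodesic γ ∧
        HausdorffClose (Set.range γ) (γ₁ '' Set.Ici 0 ∪ γ₂ '' Set.Ici 0)) ∧
  (∀ (x : X) (u : ℕ → X),
      (∀ M : ℝ, ∃ N : ℕ, ∀ n, N ≤ n → ∀ m, N ≤ m → M ≤ gromov x (u n) (u m)) →
      ∃ γ : ℝ → X, IsGeodesicRay γ ∧ γ 0 = x ∧
        ∀ M : ℝ, ∃ N : ℕ, ∀ n, N ≤ n → ∀ m, N ≤ m → M ≤ gromov x (γ (n : ℝ)) (u m))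

/-- The sequence `u` converges to the boundary point `p`, with basepoint `x`. -/
def SeqConvTo (x : X) (u : ℕ → X) (p : Boundary X) : Prop :=
  ∃ γ : GRay X, Boundary.mk γ = p ∧
    ∀ M : ℝ, ∃ N : ℕ, ∀ n, N ≤ n → ∀ m, N ≤ m → M ≤ gromov x (u n) (γ.1 (m : ℝ))

/-- `γ` is a geodesic ray in the class of the boundary point `p`. -/
def RayTo (γ : ℝ → X) (p : Boundary X) : Prop :=
  ∃ h : IsGeodesicRay γ, Boundary.mk ⟨γ, h⟩ = p

/-- `γ` is a biinfinite geodesic whose two ends converge to `p` and `q`. -/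
def BiGeodesicJoins (γ : ℝ → X) (p q : Boundary X) : Prop :=
  IsBiGeodesic γ ∧ SeqConvTo (γ 0) (fun n => γ (-(n : ℝ))) p ∧
    SeqConvTo (γ 0) (fun n => γ (n : ℝ)) q

/-- `s` is (the image of) a geodesic joining two points of `X ∪ ∂X`. -/
def JoinSet : X ⊕ Boundary X → X ⊕ Boundary X → Set X → Prop
  | Sum.inl x, Sum.inl y, s => IsGeodesicSegment s x y
  | Sum.inl x, Sum.inr p, s => ∃ γ : ℝ → X, γ 0 = x ∧ RayTo γ p ∧ s = γ '' Set.Ici 0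
  | Sum.inr p, Sum.inl x, s => ∃ γ : ℝ → X, γ 0 = x ∧ RayTo γ p ∧ s = γ '' Set.Ici 0
  | Sum.inr p, Sum.inr q, s => ∃ γ : ℝ → X, BiGeodesicJoins γ p q ∧ s = Set.range γ

/-- The convex hull `Conv(A)` of a subset `A ⊆ X ∪ ∂X`. -/
def geoConv (A : Set (X ⊕ Boundary X)) : Set X :=
  {x | (∃ a : X, A = {Sum.inl a} ∧ x = a) ∨
    ∃ p ∈ A, ∃ q ∈ A, p ≠ q ∧ ∃ s : Set X, JoinSet p q s ∧ x ∈ s}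

/-- The distance between two subsets of `X`. -/
def setDist (A B : Set X) : ℝ := sInf (Set.image2 dist A B)

/-- `a` is a projection of `p` on `A` (relative to `δ`). -/
def IsProjection (δ : ℝ) (A : Set X) (p a : X) : Prop :=
  a ∈ A ∧ ∀ a' ∈ A, dist p a ≤ dist p a' + δ

/-- `f` restricted to `[0,L]` is a unit-speed geodesic from `x` to `y`. -/
def GeodParam (f : ℝ → X) (L : ℝ) (x y : X) : Prop :=
  0 ≤ L ∧ f 0 = x ∧ f L = y ∧
    ∀ u ∈ Set.Icc (0 : ℝ) L, ∀ v ∈ Set.Icc (0 : ℝ) L, dist (f u) (f v) = |u - v|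

/-- Concatenation of three paths, the first on `[0,a]`, the second on `[0,b]`. -/
def concat3 (f₁ f₂ f₃ : ℝ → X) (a b : ℝ) : ℝ → X := fun t =>
  if t ≤ a then f₁ t else if t ≤ a + b then f₂ (t - a) else f₃ (t - a - b)

/-- `f` is a `(lam, ε)`-quasigeodesic on `[a,b]`. -/
def QuasigeodesicOn (lam ε : ℝ) (f : ℝ → X) (a b : ℝ) : Prop :=
  ∀ s ∈ Set.Icc a b, ∀ t ∈ Set.Icc a b, |s - t| ≤ lam * dist (f s) (f t) + ε

/-- The action of `G` on `X` is by isometries. -/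
def IsometricAction (G Y : Type*) [Group G] [MetricSpace Y] [MulAction G Y] : Prop :=
  ∀ (g : G) (x y : Y), dist (g • x) (g • y) = dist x y

section GroupAction

variable {G : Type*} [Group G]

/-- The limit set `Λ(U) ⊆ ∂X` of a subgroup `U ≤ G`. -/
def limitSet (X : Type*) [MetricSpace X] [MulAction G X] (U : Subgroup G) :
    Set (Boundary X) :=
  {p | ∃ x₀ : X, ∃ u : ℕ → U, SeqConvTo x₀ (fun n => ((u n : G)) • x₀) p}

/-- The small displacement set `E(U)` (relative to `δ`). -/
def smallDispSet (X : Type*) [MetricSpace X] [MulAction G X] (δ : ℝ) (U : Subgroup G) :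
    Set X :=
  {x | ∃ u : G, u ∈ U ∧ u ≠ 1 ∧ dist x (u • x) ≤ 100 * δ}

/-- `Z(U) = Conv(Λ(U) ∪ E(U))`. -/
def ZSet (X : Type*) [MetricSpace X] [MulAction G X] (δ : ℝ) (U : Subgroup G) : Set X :=
  geoConv (Sum.inr '' limitSet X U ∪ Sum.inl '' smallDispSet X δ U)

/-- The convex hull `X(U)`: the closure of `Conv(Z(U))`. -/
def cHull (X : Type*) [MetricSpace X] [MulAction G X] (δ : ℝ) (U : Subgroup G) : Set X :=
  closure (geoConv (Sum.inl '' ZSet X δ U))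

/-- The weak convex hull `X_U = Conv(Λ(U))`. -/
def weakHull (X : Type*) [MetricSpace X] [MulAction G X] (U : Subgroup G) : Set X :=
  geoConv (Sum.inr '' limitSet X U)

/-- `l_V(g) = d(X(V), gX(V))`. -/
def lV (X : Type*) [MetricSpace X] [MulAction G X] (δ : ℝ) (V : Subgroup G) (g : G) : ℝ :=
  setDist (cHull X δ V) (g • cHull X δ V)

/-- The translation length of `g`. -/
def translationLength (X : Type*) [MetricSpace X] [MulAction G X] (g : G) : ℝ :=
  sInf (Set.range fun x : X => dist x (g • x))

/-- The asymptotic translation length of `g`. -/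
def asympTranslationLength (X : Type*) [MetricSpace X] [MulAction G X] (g : G) : ℝ :=
  Filter.liminf (fun n : ℕ => translationLength X (g ^ n) / (n : ℝ)) Filter.atTop

/-- An elementary move between `G`-tuples `(U₁,…,U_n; h₁,…,h_m)`. -/
def gMove {n m : ℕ} (M M' : (Fin n → Subgroup G) × (Fin m → G)) : Prop :=
  (M'.2 = M.2 ∧ ∃ (j : Fin n) (g : G),
      g ∈ Subgroup.closure (Set.range M.2 ∪ ⋃ i ∈ {i : Fin n | i ≠ j}, ((M.1 i : Set G))) ∧
      (∀ i, i ≠ j → M'.1 i = M.1 i) ∧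
      M'.1 j = Subgroup.map (MulAut.conj g).toMonoidHom (M.1 j)) ∨
  (M'.1 = M.1 ∧ ∃ (i : Fin m) (g₁ g₂ : G),
      g₁ ∈ Subgroup.closure (M.2 '' {j : Fin m | j ≠ i} ∪ ⋃ t, ((M.1 t : Set G))) ∧
      g₂ ∈ Subgroup.closure (M.2 '' {j : Fin m | j ≠ i} ∪ ⋃ t, ((M.1 t : Set G))) ∧
      (∀ j, j ≠ i → M'.2 j = M.2 j) ∧
      M'.2 i = g₁ * M.2 i * g₂)

/-- Equivalence of `G`-tuples: a finite chain of elementary moves. -/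
def gEquiv {n m : ℕ} :
    (Fin n → Subgroup G) × (Fin m → G) → (Fin n → Subgroup G) × (Fin m → G) → Prop :=
  Relation.ReflTransGen gMove

/-- The family of factors `U₁,…,U_n, F(h₁),…,F(h_m)`. -/
def FF {n : ℕ} (m : ℕ) (U : Fin n → Subgroup G) : Fin n ⊕ Fin m → Type _
  | Sum.inl j => ↥(U j)
  | Sum.inr _ => FreeGroup PUnit

instance ffGroup {n : ℕ} (m : ℕ) (U : Fin n → Subgroup G) :
    (i : Fin n ⊕ Fin m) → Group (FF m U i)
  | Sum.inl j => inferInstanceAs (Group ↥(U j))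
  | Sum.inr _ => inferInstanceAs (Group (FreeGroup PUnit))

def ffHoms {n m : ℕ} (U : Fin n → Subgroup G) (H : Fin m → G) :
    (i : Fin n ⊕ Fin m) → FF m U i →* G
  | Sum.inl j => (U j).subtype
  | Sum.inr j => FreeGroup.lift fun _ => H j

/-- The canonical homomorphism `U₁ ∗ ⋯ ∗ U_n ∗ F(H) → G`. -/
def freeProdHom {n m : ℕ} (U : Fin n → Subgroup G) (H : Fin m → G) :
    Monoid.CoprodI (FF m U) →* G :=
  Monoid.CoprodI.lift (ffHoms U H)

/-- `W = U₁ ∗ ⋯ ∗ U_n ∗ F(H)`: the canonical homomorphism is injective with image `W`. -/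
def IsFreeProdDecomp {n m : ℕ} (U : Fin n → Subgroup G) (H : Fin m → G)
    (W : Subgroup G) : Prop :=
  Function.Injective (freeProdHom U H) ∧ (freeProdHom U H).range = W

/-- Minimality of the `G`-pair `(V; H)` (relative to a `1`-hyperbolic `G`-space `X`). -/
def PairMinimal (X : Type*) [MetricSpace X] [MulAction G X] {m : ℕ}
    (V : Subgroup G) (H : Fin m → G) : Prop :=
  ∀ (V' : Subgroup G) (H' : Fin m → G),
    gEquiv ((fun _ : Fin 1 => V), H) ((fun _ : Fin 1 => V'), H') →
    (∑ i, lV X 1 V (H i)) ≤ (∑ i, lV X 1 V' (H' i)) + 1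

/-- An elementary Nielsen move on tuples of elements of `G`. -/
def NielsenMove {k : ℕ} (g g' : Fin k → G) : Prop :=
  (∃ i : Fin k, (∀ j, j ≠ i → g' j = g j) ∧ g' i = (g i)⁻¹) ∨
  (∃ i j : Fin k, i ≠ j ∧ (∀ t, t ≠ i → g' t = g t) ∧ g' i = g i * g j) ∨
  (∃ i j : Fin k, i ≠ j ∧ g' = g ∘ Equiv.swap i j)

/-- Nielsen equivalence: a finite chain of elementary Nielsen moves. -/
def NielsenEq {k : ℕ} : (Fin k → G) → (Fin k → G) → Prop :=
  Relation.ReflTransGen NielsenMove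

/-- Word length of `g` with respect to the (symmetrized) generating set `S`. -/
def wordLength (S : Set G) (g : G) : ℕ :=
  sInf {n : ℕ | ∃ f : Fin n → G, (∀ i, f i ∈ S ∨ (f i)⁻¹ ∈ S) ∧ (List.ofFn f).prod = g}

/-- `(X, ι)` is a model of the Cayley graph `Γ(G,S)`. -/
def IsCayleyGraph (G : Type*) [Group G] (S : Set G) (X : Type*) [MetricSpace X]
    [MulAction G X] (ι : G → X) : Prop :=
  IsometricAction G X ∧
  (∀ g h : G, ι (g * h) = g • ι h) ∧
  Function.Injective ι ∧
  GeodesicSpace X ∧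
  (∀ g h : G, dist (ι g) (ι h) = (wordLength S (g⁻¹ * h) : ℝ)) ∧
  ∀ x : X, ∃ g h : G, wordLength S (g⁻¹ * h) ≤ 1 ∧
    ∃ s : Set X, IsGeodesicSegment s (ι g) (ι h) ∧ x ∈ s

/-- `H` is a quasiconvex subgroup (with respect to the Cayley graph model `(X, ι)`). -/
def QCSubgroup (X : Type*) [MetricSpace X] (ι : G → X) (H : Subgroup G) : Prop :=
  ∃ ε : ℝ, 0 ≤ ε ∧ Quasiconvex ε (ι '' (H : Set G))

end GroupAction

/-- Every nontrivial element of finite order has finite centralizer. -/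
def AlmostTorsionFree (G : Type*) [Group G] : Prop :=
  ∀ g : G, g ≠ 1 → IsOfFinOrder g → ((Subgroup.centralizer {g} : Subgroup G) : Set G).Finite

/-- `U` is nontrivial and admits no nontrivial free product decomposition. -/
def FreelyIndecomposable (U : Type*) [Group U] : Prop :=
  Nontrivial U ∧
    ¬ ∃ A B : Subgroup U, A ≠ ⊥ ∧ B ≠ ⊥ ∧
        Function.Bijective (Monoid.Coprod.lift A.subtype B.subtype)

def InfiniteCyclic (U : Type*) [Group U] : Prop := Infinite U ∧ IsCyclic U

def VirtuallyCyclic (U : Type*) [Group U] : Prop :=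
  ∃ H : Subgroup U, H.index ≠ 0 ∧ IsCyclic ↥H

def NonElementary (U : Type*) [Group U] : Prop := ¬ Finite U ∧ ¬ VirtuallyCyclic U

end KW

universe u

namespace KWP

open KW


/-- A left-invariant, proper, geodesic, hyperbolic length function. -/
structure Geo {G : Type u} [Group G] (len : G → ℕ) (D : ℕ) : Prop where
  one : len 1 = 0
  inv : ∀ g, len g⁻¹ = len g
  mul : ∀ g h, len (g * h) ≤ len g + len h
  ball : ∀ n, {g : G | len g ≤ n}.Finite
  split : ∀ g n, n ≤ len g → ∃ a b, g = a * b ∧ len a = n ∧ len b = len g - n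
  hyp4 : ∀ x y z w : G, len (x⁻¹ * z) + len (y⁻¹ * w) ≤
    max (len (x⁻¹ * y) + len (z⁻¹ * w)) (len (x⁻¹ * w) + len (y⁻¹ * z)) + D

def Orth {G : Type u} [Group G] (len : G → ℕ) (H : Subgroup G) (k : G) : Prop :=
  ∀ h ∈ H, len k ≤ len (h * k)

def QCc {G : Type u} [Group G] (len : G → ℕ) (H : Subgroup G) (c : ℕ) : Prop :=
  ∀ k, Orth len H k → ∀ h ∈ H, len h + len k ≤ len (h⁻¹ * k) + c

section word

variable {G : Type u} [Group G] (S : Set G)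

def IsWord (n : ℕ) (g : G) : Prop :=
  ∃ f : Fin n → G, (∀ i, f i ∈ S ∨ (f i)⁻¹ ∈ S) ∧ (List.ofFn f).prod = g

theorem isWord_iff (n : ℕ) (g : G) : IsWord S n g ↔
    ∃ L : List G, L.length = n ∧ (∀ s ∈ L, s ∈ S ∨ s⁻¹ ∈ S) ∧ L.prod = g := by
  constructor
  · rintro ⟨f, hf, rfl⟩
    refine ⟨List.ofFn f, by simp, ?_, rfl⟩
    intro s hs
    rw [List.mem_ofFn] at hs
    obtain ⟨i, rfl⟩ := hs
    exact hf i
  · rintro ⟨L, rfl, h, rfl⟩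
    exact ⟨L.get, fun i => h _ (List.get_mem _ _), by rw [List.ofFn_get]⟩

theorem isWord_exists (hS : Subgroup.closure S = ⊤) (g : G) : ∃ n, IsWord S n g := by
  have hg : g ∈ Subgroup.closure S := by rw [hS]; trivial
  rw [← Subgroup.mem_toSubmonoid, Subgroup.closure_toSubmonoid] at hg
  obtain ⟨L, hL, hp⟩ := Submonoid.exists_list_of_mem_closure hg
  exact ⟨L.length, (isWord_iff S _ _).2 ⟨L, rfl, hL, hp⟩⟩

theorem wl_spec (hS : Subgroup.closure S = ⊤) (g : G) : IsWord S (wordLength S g) g :=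
  Nat.sInf_mem (s := {n | IsWord S n g}) (isWord_exists S hS g)

theorem wl_le {n : ℕ} {g : G} (h : IsWord S n g) : wordLength S g ≤ n :=
  Nat.sInf_le h

theorem wl_mul (hS : Subgroup.closure S = ⊤) (g h : G) :
    wordLength S (g * h) ≤ wordLength S g + wordLength S h := by
  obtain ⟨L, hL, hs, hp⟩ := (isWord_iff S _ _).1 (wl_spec S hS g)
  obtain ⟨L', hL', hs', hp'⟩ := (isWord_iff S _ _).1 (wl_spec S hS h)
  refine wl_le S ((isWord_iff S _ _).2 ⟨L ++ L', by simp [hL, hL'], ?_, by simp [hp, hp']⟩)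
  intro s h
  rcases List.mem_append.1 h with h | h
  · exact hs s h
  · exact hs' s h

theorem wl_split (hS : Subgroup.closure S = ⊤) (g : G) (n : ℕ) (hn : n ≤ wordLength S g) :
    ∃ a b, g = a * b ∧ wordLength S a = n ∧ wordLength S b = wordLength S g - n := by
  obtain ⟨L, hL, hs, hp⟩ := (isWord_iff S _ _).1 (wl_spec S hS g)
  have e : g = (L.take n).prod * (L.drop n).prod := by rw [List.prod_take_mul_prod_drop, hp]
  have ha : wordLength S (L.take n).prod ≤ n :=
    wl_le S ((isWord_iff S _ _).2 ⟨L.take n, by simp [hL, hn],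
      fun s h => hs s (List.mem_of_mem_take h), rfl⟩)
  have hb : wordLength S (L.drop n).prod ≤ wordLength S g - n :=
    wl_le S ((isWord_iff S _ _).2 ⟨L.drop n, by simp [hL],
      fun s h => hs s (List.mem_of_mem_drop h), rfl⟩)
  have := wl_mul S hS (L.take n).prod (L.drop n).prod
  rw [← e] at this
  exact ⟨_, _, e, by omega, by omega⟩

theorem wl_ball (hfin : S.Finite) (hS : Subgroup.closure S = ⊤) (n : ℕ) :
    {g : G | wordLength S g ≤ n}.Finite := by
  have hT : {s : G | s ∈ S ∨ s⁻¹ ∈ S}.Finite := by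
    refine (hfin.union (hfin.inv)).subset ?_
    rintro s (h | h)
    · exact Or.inl h
    · exact Or.inr h
  have hw : ∀ n, {g : G | IsWord S n g}.Finite := by
    intro n
    have hpi : {f : Fin n → G | ∀ i, f i ∈ {s : G | s ∈ S ∨ s⁻¹ ∈ S}}.Finite :=
      Set.Finite.pi' fun _ => hT
    refine (hpi.image fun f => (List.ofFn f).prod).subset ?_
    rintro g ⟨f, hf, rfl⟩
    exact ⟨f, hf, rfl⟩
  have : {g : G | wordLength S g ≤ n} ⊆ ⋃ m ∈ Finset.range (n + 1), {g : G | IsWord S m g} := by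
    intro g hg
    simp only [Set.mem_iUnion]
    exact ⟨wordLength S g, by simpa [Nat.lt_succ_iff] using hg, wl_spec S hS g⟩
  exact (Set.Finite.biUnion (Finset.finite_toSet _) fun m _ => hw m).subset this

end word

section hyp

variable {X : Type u} [MetricSpace X]

theorem seg_dist {s : Set X} {x y p : X} (h : IsGeodesicSegment s x y) (hp : p ∈ s) :
    dist x p + dist p y = dist x y := by
  obtain ⟨b, f, hb, h0, h1, hf, rfl⟩ := h
  obtain ⟨t, ht, rfl⟩ := hp
  rw [← h0, ← h1, hf 0 ⟨le_refl _, hb⟩ t ht, hf t ht b ⟨hb, le_refl _⟩,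
    hf 0 ⟨le_refl _, hb⟩ b ⟨hb, le_refl _⟩]
  rw [abs_of_nonpos (by linarith [ht.1]), abs_of_nonpos (by linarith [ht.2]),
    abs_of_nonpos (by linarith)]
  ring

theorem seg_symm {s : Set X} {x y : X} (h : IsGeodesicSegment s x y) :
    IsGeodesicSegment s y x := by
  obtain ⟨b, f, hb, h0, h1, hf, rfl⟩ := h
  refine ⟨b, fun t => f (b - t), hb, by simpa using h1, by simpa using h0, ?_, ?_⟩
  · intro u hu v hv
    rw [hf _ ⟨by linarith [hu.2], by linarith [hu.1]⟩ _ ⟨by linarith [hv.2], by linarith [hv.1]⟩]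
    rw [show b - u - (b - v) = -(u - v) by ring, abs_neg]
  · ext p
    constructor
    · rintro ⟨t, ht, rfl⟩
      exact ⟨b - t, ⟨by linarith [ht.2], by linarith [ht.1]⟩, by simp⟩
    · rintro ⟨t, ht, rfl⟩
      exact ⟨b - t, ⟨by linarith [ht.2], by linarith [ht.1]⟩, rfl⟩

/-- the point on a segment at a given distance -/
theorem seg_point {s : Set X} {x y : X} (h : IsGeodesicSegment s x y) {t : ℝ} (h0 : 0 ≤ t)
    (ht : t ≤ dist x y) : ∃ p ∈ s, dist x p = t := by
  obtain ⟨b, f, hb, hx, hy, hf, rfl⟩ := h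
  have hxy : dist x y = b := by
    rw [← hx, ← hy, hf 0 ⟨le_refl _, hb⟩ b ⟨hb, le_refl _⟩, abs_of_nonpos (by linarith)]; ring
  refine ⟨f t, ⟨t, ⟨h0, by linarith⟩, rfl⟩, ?_⟩
  rw [← hx, hf 0 ⟨le_refl _, hb⟩ t ⟨h0, by linarith⟩, abs_of_nonpos (by linarith)]; ring

theorem near_point {δ : ℝ} (hδ : 0 ≤ δ) (hX : DeltaHyperbolic δ X) (x y w : X) :
    ∃ s : Set X, IsGeodesicSegment s x y ∧ ∃ p ∈ s,
      2 * dist w p ≤ dist w x + dist w y - dist x y + 4 * (δ + 1) := by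
  obtain ⟨s, hs⟩ := hX.1 x y
  obtain ⟨s2, hs2⟩ := hX.1 y w
  obtain ⟨s3, hs3⟩ := hX.1 x w
  refine ⟨s, hs, ?_⟩
  have thin := hX.2 x y w s s2 s3 hs hs2 hs3
  obtain ⟨b, f, hb, hx, hy, hf, hseq⟩ := id hs
  have ne2 : s2.Nonempty := by
    obtain ⟨b', f', hb', h0, -, -, rfl⟩ := hs2
    exact ⟨f' 0, 0, ⟨le_refl _, hb'⟩, rfl⟩
  have ne3 : s3.Nonempty := by
    obtain ⟨b', f', hb', h0, -, -, rfl⟩ := hs3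
    exact ⟨f' 0, 0, ⟨le_refl _, hb'⟩, rfl⟩
  have hy2 : y ∈ s2 := by
    obtain ⟨b', f', hb', h0, -, -, rfl⟩ := hs2
    exact ⟨0, ⟨le_refl _, hb'⟩, h0⟩
  have hx3 : x ∈ s3 := by
    obtain ⟨b', f', hb', h0, -, -, rfl⟩ := hs3
    exact ⟨0, ⟨le_refl _, hb'⟩, h0⟩
  have fc : ContinuousOn f (Set.Icc 0 b) := by
    apply LipschitzOnWith.continuousOn (K := 1)
    apply LipschitzOnWith.of_dist_le_mul
    intro u hu v hv
    rw [hf u hu v hv, Real.dist_eq]; simp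
  have key : ∃ t ∈ Set.Icc (0:ℝ) b, Metric.infDist (f t) s2 ≤ δ ∧ Metric.infDist (f t) s3 ≤ δ := by
    have hpre : IsPreconnected (Set.Icc (0:ℝ) b) := isPreconnected_Icc
    rw [isPreconnected_closed_iff] at hpre
    have c2 : IsClosed (Set.Icc (0:ℝ) b ∩ (fun t => Metric.infDist (f t) s2) ⁻¹' Set.Iic δ) :=
      ContinuousOn.preimage_isClosed_of_isClosed
        ((Metric.continuous_infDist_pt s2).comp_continuousOn fc) isClosed_Icc isClosed_Iic
    have c3 : IsClosed (Set.Icc (0:ℝ) b ∩ (fun t => Metric.infDist (f t) s3) ⁻¹' Set.Iic δ) :=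
      ContinuousOn.preimage_isClosed_of_isClosed
        ((Metric.continuous_infDist_pt s3).comp_continuousOn fc) isClosed_Icc isClosed_Iic
    suffices hh : (Set.Icc (0:ℝ) b ∩ ((Set.Icc (0:ℝ) b ∩
        (fun t => Metric.infDist (f t) s2) ⁻¹' Set.Iic δ) ∩ (Set.Icc (0:ℝ) b ∩
        (fun t => Metric.infDist (f t) s3) ⁻¹' Set.Iic δ))).Nonempty by
      obtain ⟨t, ht, h2, h3⟩ := hh
      exact ⟨t, ht, h2.2, h3.2⟩
    refine hpre _ _ c2 c3 ?_ ?_ ?_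
    · intro t ht
      obtain ⟨q, hq, hd⟩ := thin (f t) (by rw [hseq]; exact ⟨t, ht, rfl⟩)
      rcases hq with hq | hq
      · left; exact ⟨ht, (Metric.infDist_le_dist_of_mem hq).trans hd⟩
      · right; exact ⟨ht, (Metric.infDist_le_dist_of_mem hq).trans hd⟩
    · refine ⟨b, ⟨hb, le_refl _⟩, ⟨hb, le_refl _⟩, ?_⟩
      show Metric.infDist (f b) s2 ≤ δ
      rw [hy]; exact (Metric.infDist_le_dist_of_mem hy2).trans (by simpa using hδ)
    · refine ⟨0, ⟨le_refl _, hb⟩, ⟨le_refl _, hb⟩, ?_⟩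
      show Metric.infDist (f 0) s3 ≤ δ
      rw [hx]; exact (Metric.infDist_le_dist_of_mem hx3).trans (by simpa using hδ)
  obtain ⟨t, ht, h2, h3⟩ := key
  have hp : f t ∈ s := by rw [hseq]; exact ⟨t, ht, rfl⟩
  obtain ⟨q2, hq2, d2⟩ := (Metric.infDist_lt_iff ne2).1 (lt_of_le_of_lt h2 (lt_add_one δ))
  obtain ⟨q3, hq3, d3⟩ := (Metric.infDist_lt_iff ne3).1 (lt_of_le_of_lt h3 (lt_add_one δ))
  refine ⟨f t, hp, ?_⟩
  have e1 := seg_dist hs hp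
  have e2 := seg_dist hs2 hq2
  have e3 := seg_dist hs3 hq3
  have a1 := dist_triangle w q2 (f t)
  have a2 := dist_triangle w q3 (f t)
  have a3 := dist_triangle (f t) q2 y
  have a4 := dist_triangle x q3 (f t)
  rw [dist_comm w q2, dist_comm q2 (f t)] at a1
  rw [dist_comm w q3, dist_comm q3 (f t)] at a2
  rw [dist_comm q3 (f t)] at a4
  rw [dist_comm q2 w] at a1
  have b1 := dist_triangle x q3 (f t)
  have b3 := dist_triangle (f t) q2 y
  rw [dist_comm y w, dist_comm y q2, dist_comm q2 w] at e2
  rw [dist_comm q3 w] at e3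
  rw [dist_comm q3 w] at a2
  rw [dist_comm x w] at e3
  have := dist_comm q3 (f t)
  linarith

theorem four_point {δ : ℝ} (hδ : 0 ≤ δ) (hX : DeltaHyperbolic δ X) (x y z w : X) :
    dist x z + dist y w ≤ max (dist x y + dist z w) (dist x w + dist y z) + (10 * δ + 10) := by
  obtain ⟨s, hs, p, hp, hd⟩ := near_point hδ hX x z w
  obtain ⟨s1, hs1⟩ := hX.1 x y
  obtain ⟨s2, hs2⟩ := hX.1 y z
  obtain ⟨q, hq, hpq⟩ := hX.2 x z y s s2 s1 hs (seg_symm hs2) hs1 p hp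
  have t1 := dist_triangle w p q
  rcases hq with hq | hq
  · have e := seg_dist hs2 hq
    have a1 := dist_triangle y q w
    have a2 := dist_triangle w q z
    rw [dist_comm q w] at a1
    have := le_max_right (dist x y + dist z w) (dist x w + dist y z)
    have := dist_comm z w
    have := dist_comm x w
    linarith
  · have e := seg_dist hs1 hq
    have a1 := dist_triangle y q w
    have a2 := dist_triangle w q x
    rw [dist_comm q w] at a1
    have := le_max_left (dist x y + dist z w) (dist x w + dist y z)
    have := dist_comm z w
    have := dist_comm x w
    have := dist_comm x q
    have := dist_comm y q
    linarith

end hyp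

theorem geo_of_cayley {G : Type u} [Group G] {S : Finset G} {X : Type u} [MetricSpace X]
    [MulAction G X] {ι : G → X} {δ : ℝ} (hδ : 0 ≤ δ) (hS : Subgroup.closure (S : Set G) = ⊤)
    (hC : IsCayleyGraph G (S : Set G) X ι) (hX : DeltaHyperbolic δ X) :
    ∃ D, Geo (wordLength (S : Set G)) D := by
  obtain ⟨-, -, -, -, hd, -⟩ := hC
  refine ⟨⌈10 * δ + 10⌉₊, ?_, ?_, wl_mul _ hS, wl_ball _ S.finite_toSet hS, wl_split _ hS, ?_⟩
  · have := hd 1 1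
    simpa using this.symm
  · intro g
    have h1 := hd 1 g
    have h2 := hd g 1
    rw [dist_comm, h1] at h2
    simp at h2
    exact_mod_cast h2.symm
  · intro x y z w
    have := four_point hδ hX (ι x) (ι y) (ι z) (ι w)
    simp only [hd] at this
    have h2 := Nat.le_ceil (10 * δ + 10)
    have h3 : ((wordLength (S : Set G) (x⁻¹ * z) : ℝ) + wordLength (S : Set G) (y⁻¹ * w)) ≤
      max ((wordLength (S : Set G) (x⁻¹ * y) : ℝ) + wordLength (S : Set G) (z⁻¹ * w))
        (wordLength (S : Set G) (x⁻¹ * w) + wordLength (S : Set G) (y⁻¹ * z)) +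
        (⌈10 * δ + 10⌉₊ : ℝ) := by linarith
    exact_mod_cast h3

theorem qc_of_qc {G : Type u} [Group G] {S : Finset G} {X : Type u} [MetricSpace X]
    [MulAction G X] {ι : G → X} {δ : ℝ} (hδ : 0 ≤ δ)
    (hC : IsCayleyGraph G (S : Set G) X ι) (hX : DeltaHyperbolic δ X) (H : Subgroup G)
    (hH : QCSubgroup X ι H) :
    ∃ c, QCc (wordLength (S : Set G)) H c := by
  obtain ⟨-, -, -, -, hd, -⟩ := hC
  obtain ⟨ε, hε, hq⟩ := hH
  refine ⟨⌈2 * ((10 * δ + 10) + ε)⌉₊, ?_⟩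
  intro k hk h hh
  obtain ⟨s, hs⟩ := hX.1 (ι 1) (ι h)
  set τ := (dist (ι 1) (ι h) + dist (ι 1) (ι k) - dist (ι h) (ι k)) / 2 with hτ
  have t1 := dist_triangle (ι h) (ι 1) (ι k)
  have t2 := dist_triangle (ι 1) (ι h) (ι k)
  rw [dist_comm (ι h) (ι 1)] at t1
  obtain ⟨p, hp, hpd⟩ := seg_point hs (t := τ) (by linarith) (by linarith)
  obtain ⟨a, ha, hpa⟩ := hq _ ⟨1, H.one_mem, rfl⟩ _ ⟨h, hh, rfl⟩ s hs p hp
  obtain ⟨a, haH, rfl⟩ := ha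
  have e := seg_dist hs hp
  have f := four_point hδ hX (ι 1) p (ι h) (ι k)
  have t3 := dist_triangle (ι a) p (ι k)
  rw [dist_comm (ι a) p] at t3
  have g : dist (ι 1) (ι k) ≤ dist (ι a) (ι k) := by
    rw [hd, hd]
    have := hk a⁻¹ (H.inv_mem haH)
    simp only [inv_one, one_mul]
    exact_mod_cast this
  have f' : dist p (ι k) ≤ dist (ι 1) (ι k) - τ + (10 * δ + 10) := by
    rcases max_cases (dist (ι 1) p + dist (ι h) (ι k)) (dist (ι 1) (ι k) + dist p (ι h)) with
      ⟨h1, -⟩ | ⟨h1, -⟩ <;> rw [h1] at f <;> linarith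
  have fin : dist (ι 1) (ι h) + dist (ι 1) (ι k) ≤
      dist (ι h) (ι k) + 2 * ((10 * δ + 10) + ε) := by linarith
  simp only [hd, inv_one, one_mul] at fin
  have h2 := Nat.le_ceil (2 * ((10 * δ + 10) + ε))
  have h3 : ((wordLength (S : Set G) h : ℝ) + wordLength (S : Set G) k) ≤
    wordLength (S : Set G) (h⁻¹ * k) + (⌈2 * ((10 * δ + 10) + ε)⌉₊ : ℝ) := by linarith
  exact_mod_cast h3

end KWP

namespace KWP

open KW


section local_geometry

variable {G : Type u} [Group G] {len : G → ℕ} {D : ℕ}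

def dd (len : G → ℕ) (x y : G) : ℕ := len (x⁻¹ * y)

theorem dd_comm (hG : Geo len D) (x y : G) : dd len x y = dd len y x := by
  unfold dd; rw [← hG.inv]; simp

theorem dd_tri (hG : Geo len D) (x y z : G) : dd len x z ≤ dd len x y + dd len y z := by
  unfold dd
  have := hG.mul (x⁻¹ * y) (y⁻¹ * z)
  rwa [show x⁻¹ * y * (y⁻¹ * z) = x⁻¹ * z by group] at this

theorem dd_left (g x y : G) : dd len (g * x) (g * y) = dd len x y := by
  unfold dd; congr 1; group

theorem dd_four (hG : Geo len D) (x y z w : G) : dd len x z + dd len y w ≤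
    max (dd len x y + dd len z w) (dd len x w + dd len y z) + D := hG.hyp4 x y z w

theorem dd_one (x : G) : dd len 1 x = len x := by simp [dd]

theorem dd_self (hG : Geo len D) (x : G) : dd len x x = 0 := by simp [dd, hG.one]

theorem dd_mul (x y : G) : dd len x (x * y) = len y := by simp [dd]

/-- the middle piece of a broken geodesic is long -/
theorem big_case (hG : Geo len D) {H : Subgroup G} {c : ℕ} (hc : QCc len H c) {a b h : G}
    (ha : Orth len H a) (hb : Orth len H b) (hh : h ∈ H) (hbig : D + 2 * c < 2 * len h) :
    len a + len b + len h ≤ dd len a (h * b) + 2 * c + D := by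
  have h1 := hc a ha h hh
  have h2 := hc b hb h⁻¹ (H.inv_mem hh)
  rw [inv_inv, hG.inv] at h2
  have h3 := dd_four hG a 1 h (h * b)
  rw [dd_comm hG a 1, dd_one, dd_one, dd_one, dd_mul, dd_comm hG a h] at h3
  have h4 : dd len h a = len (h⁻¹ * a) := rfl
  rw [h4] at h3
  omega

theorem propP (hG : Geo len D) (hATF : AlmostTorsionFree G) {H : Subgroup G} {c : ℕ}
    (hc : QCc len H c) (D1 : ℕ) :
    ∃ cP : ℕ, ∀ a h, Orth len H a → h ∈ H → h ≠ 1 → dd len a (h * a) ≤ D1 → len a ≤ cP := by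
  classical
  have each : ∀ h : G, ∃ b : ℕ, ∀ a, Orth len H a → h ∈ H → h ≠ 1 → dd len a (h * a) ≤ D1 →
      len a ≤ b := by
    intro h
    by_cases hH : h ∈ H ∧ h ≠ 1
    swap
    · exact ⟨0, fun a _ h1 h2 => absurd ⟨h1, h2⟩ hH⟩
    by_cases hfo : IsOfFinOrder h
    · have hcent := hATF h hH.2 hfo
      have hfin : {a : G | dd len a (h * a) ≤ D1}.Finite := by
        have : {a : G | dd len a (h * a) ≤ D1} ⊆
            ⋃ s ∈ {s : G | len s ≤ D1}, {a : G | a⁻¹ * h * a = s} := by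
          intro a ha
          simp only [Set.mem_iUnion]
          refine ⟨a⁻¹ * h * a, ?_, rfl⟩
          have : dd len a (h * a) = len (a⁻¹ * h * a) := by simp [dd, mul_assoc]
          show len _ ≤ D1
          rw [← this]; exact ha
        refine (Set.Finite.biUnion (hG.ball D1) ?_).subset this
        intro s _
        by_cases hne : ∃ a0, a0⁻¹ * h * a0 = s
        · obtain ⟨a0, ha0⟩ := hne
          refine (hcent.image fun x => x * a0).subset ?_
          intro a ha
          refine ⟨a * a0⁻¹, ?_, by group⟩
          have ha : a⁻¹ * h * a = s := ha
          rw [SetLike.mem_coe, Subgroup.mem_centralizer_singleton_iff]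
          have e : h = a * (a0⁻¹ * h * a0) * a⁻¹ := by rw [ha0, ← ha]; group
          have e2 : h * a = a * (a0⁻¹ * h * a0) := by
            conv_lhs => rw [e]
            group
          calc a * a0⁻¹ * h = (a * (a0⁻¹ * h * a0)) * a0⁻¹ := by group
            _ = h * (a * a0⁻¹) := by rw [← e2]; group
        · refine Set.Finite.subset Set.finite_empty ?_
          intro a ha
          exact hne ⟨a, ha⟩
      obtain ⟨b, hb⟩ := (hfin.image len).bddAbove
      exact ⟨b, fun a _ _ _ h2 => hb ⟨a, h2, rfl⟩⟩
    · have hex : ∃ k : ℕ, D + 2 * c < 2 * len (h ^ k) := by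
        by_contra hno
        push Not at hno
        have hinj : Function.Injective fun k : ℕ => h ^ k :=
          injective_pow_iff_not_isOfFinOrder.2 hfo
        have : (Set.range fun k : ℕ => h ^ k).Finite := by
          refine (hG.ball (D + 2 * c)).subset ?_
          rintro _ ⟨k, rfl⟩
          have := hno k
          show len (h ^ k) ≤ _
          omega
        exact Set.infinite_range_of_injective hinj this
      obtain ⟨k, hk⟩ := hex
      refine ⟨k * D1 + 2 * c + D, fun a ha h1 h2 h3 => ?_⟩
      have h4 := big_case hG hc ha ha (H.pow_mem h1 k) hk
      have h5 : ∀ n : ℕ, dd len a (h ^ n * a) ≤ n * D1 := by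
        intro n
        induction n with
        | zero => simp [dd_self hG]
        | succ n ih =>
          have t := dd_tri hG a (h ^ n * a) (h ^ (n + 1) * a)
          have e : dd len (h ^ n * a) (h ^ (n + 1) * a) = dd len a (h * a) := by
            rw [pow_succ, mul_assoc, dd_left]
          rw [e] at t
          rw [Nat.succ_mul]
          omega
      have := h5 k
      omega
  choose b hb using each
  obtain ⟨B, hB⟩ := ((hG.ball (D + 2 * c)).image b).bddAbove
  refine ⟨max B (D1 + 2 * c + D), fun a h ha hh hne hd => ?_⟩
  by_cases hs : D + 2 * c < 2 * len h
  · have := big_case hG hc ha ha hh hs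
    have := le_max_right B (D1 + 2 * c + D)
    omega
  · have h1 := hb h a ha hh hne hd
    have h2 : b h ≤ B := hB ⟨h, by show len h ≤ _; omega, rfl⟩
    have := le_max_left B (D1 + 2 * c + D)
    omega

theorem fold_close (hG : Geo len D) {C t : ℕ} {a a1 a2 b b1 b2 h : G}
    (ea : a = a1 * a2) (eb : b = b1 * b2) (la1 : len a1 = t) (lb1 : len b1 = t)
    (la : len a = t + len a2) (lb : len b = t + len b2) (hh : len h ≤ C)
    (hs : dd len a (h * b) + 2 * t ≤ len a + len b) :
    dd len a1 (h * b1) ≤ C + 2 * D := by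
  have f1 := dd_four hG a1 1 (h * b) a
  have f2 := dd_four hG a1 h (h * b1) (h * b)
  have e1 : dd len a1 a = len a2 := by rw [ea, dd_mul]
  have e2 : dd len (h * b1) (h * b) = len b2 := by rw [dd_left, eb, dd_mul]
  have e3 : dd len h (h * b) = len b := dd_mul _ _
  have e4 : dd len h (h * b1) = t := by rw [dd_mul, lb1]
  have e5 : dd len 1 (h * b) ≤ C + len b := by
    rw [dd_one]; have := hG.mul h b; omega
  have e6 : dd len a1 h ≤ t + C := by
    have := dd_tri hG a1 1 h
    rw [dd_comm hG a1 1, dd_one, dd_one] at this; omega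
  have e7 : dd len 1 a = len a := dd_one a
  have e8 : dd len a1 1 = t := by rw [dd_comm hG, dd_one, la1]
  have e9 := dd_comm hG (h * b) a
  rcases le_total (dd len a1 1 + dd len (h * b) a) (dd len a1 a + dd len 1 (h * b)) with m | m
  · rw [max_eq_right m] at f1
    rcases le_total (dd len a1 h + dd len (h * b1) (h * b))
      (dd len a1 (h * b) + dd len h (h * b1)) with m' | m'
    · rw [max_eq_right m'] at f2; omega
    · rw [max_eq_left m'] at f2; omega
  · rw [max_eq_left m] at f1
    rcases le_total (dd len a1 h + dd len (h * b1) (h * b))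
      (dd len a1 (h * b) + dd len h (h * b1)) with m' | m'
    · rw [max_eq_right m'] at f2; omega
    · rw [max_eq_left m'] at f2; omega

/-- inductive step of the local-to-global argument -/
theorem ltg_step (hG : Geo len D) {c c4 c5 K : ℕ} {o y x y' x' : G}
    (hc5 : c5 = c4 + D) (hK : 4 * c5 + 4 * c4 + 4 * c + 4 * D + 4 ≤ K)
    (hyx : K ≤ dd len y x) (hyx' : K ≤ dd len y' x')
    (ih : dd len o y + dd len y x ≤ dd len o x + c5)
    (l2 : dd len y' y + dd len y' x' ≤ dd len y x' + c4)
    (l3 : dd len x y + dd len x y' ≤ dd len y y' + c) :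
    dd len o y' + dd len y' x' ≤ dd len o x' + c5 ∧ dd len o x ≤ dd len o x' := by
  have s1 := dd_comm hG x y
  have s2 := dd_comm hG y y'
  have f1 := dd_four hG o y x y'
  have f2 := dd_four hG o x' y' y
  have s3 := dd_comm hG x' y
  have s4 := dd_comm hG x' y'
  have t2 := dd_tri hG o x' x
  have t4 := dd_comm hG x x'
  have t1 := dd_tri hG y x y'
  rw [← Nat.sub_le_iff_le_add, le_max_iff, Nat.sub_le_iff_le_add, Nat.sub_le_iff_le_add] at f1 f2
  have f1' : dd len o x + dd len y y' ≤ dd len o y' + dd len y x + D := by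
    rcases f1 with f1 | f1 <;> omega
  have f2' : dd len o y' + dd len x' y ≤ dd len o x' + dd len y' y + D := by
    rcases f2 with f2 | f2 <;> omega
  constructor <;> omega

end local_geometry

end KWP

namespace KWP

open KW


/-- Finite graphs with vertex groups in `G` and edges labelled by elements of `G`. -/
structure LG (G : Type u) [Group G] where
  V : Type
  E : Type
  fV : Fintype V
  fE : Fintype E
  H : V → Subgroup G
  r : V → ℕ
  src : E → V
  tgt : E → V
  lab : E → G

attribute [instance] LG.fV LG.fE

namespace LG

variable {G : Type u} [Group G]

def hs (A : LG G) (η : A.E × Bool) : A.V := bif η.2 then A.src η.1 else A.tgt η.1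
def ht (A : LG G) (η : A.E × Bool) : A.V := bif η.2 then A.tgt η.1 else A.src η.1
def hl (A : LG G) (η : A.E × Bool) : G := bif η.2 then A.lab η.1 else (A.lab η.1)⁻¹
def rv {E : Type} (η : E × Bool) : E × Bool := (η.1, !η.2)

theorem rv_rv {E : Type} (η : E × Bool) : rv (rv η) = η := by simp [rv]

theorem hs_rv (A : LG G) (η : A.E × Bool) : A.hs (rv η) = A.ht η := by
  obtain ⟨e, b⟩ := η; cases b <;> rfl

theorem ht_rv (A : LG G) (η : A.E × Bool) : A.ht (rv η) = A.hs η := by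
  obtain ⟨e, b⟩ := η; cases b <;> rfl

theorem hl_rv (A : LG G) (η : A.E × Bool) : A.hl (rv η) = (A.hl η)⁻¹ := by
  obtain ⟨e, b⟩ := η; cases b <;> simp [hl, rv]

inductive Reach (A : LG G) (u : A.V) : A.V → G → Prop
  | refl : Reach A u u 1
  | vert {v g h} : Reach A u v g → h ∈ A.H v → Reach A u v (g * h)
  | edge {g} (η : A.E × Bool) : Reach A u (A.hs η) g → Reach A u (A.ht η) (g * A.hl η)

theorem Reach.trans {A : LG G} {u v w : A.V} {g h : G} (h1 : A.Reach u v g)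
    (h2 : A.Reach v w h) : A.Reach u w (g * h) := by
  induction h2 with
  | refl => simpa using h1
  | vert _ hh ih => rw [← mul_assoc]; exact ih.vert hh
  | edge η _ ih => rw [← mul_assoc]; exact ih.edge η

theorem Reach.ofVert {A : LG G} {v : A.V} {h : G} (hh : h ∈ A.H v) : A.Reach v v h := by
  simpa using (Reach.refl (A := A) (u := v)).vert hh

theorem Reach.ofHalf {A : LG G} (η : A.E × Bool) : A.Reach (A.hs η) (A.ht η) (A.hl η) := by
  simpa using (Reach.refl (A := A) (u := A.hs η)).edge η

theorem Reach.ofEdge {A : LG G} (e : A.E) : A.Reach (A.src e) (A.tgt e) (A.lab e) :=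
  Reach.ofHalf (A := A) (e, true)

theorem Reach.symm {A : LG G} {u v : A.V} {g : G} (h1 : A.Reach u v g) : A.Reach v u g⁻¹ := by
  induction h1 with
  | refl => simpa using Reach.refl
  | vert _ hh ih => rw [mul_inv_rev]; exact (Reach.ofVert (Subgroup.inv_mem _ hh)).trans ih
  | edge η _ ih =>
    rw [mul_inv_rev]
    have := Reach.ofHalf (A := A) (rv η)
    rw [hs_rv, ht_rv, hl_rv] at this
    exact this.trans ih

/-- the group of the graph at a vertex -/
def pi (A : LG G) (v : A.V) : Subgroup G where
  carrier := {g | A.Reach v v g}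
  one_mem' := Reach.refl
  mul_mem' := fun h1 h2 => h1.trans h2
  inv_mem' := fun h => h.symm

theorem mem_pi {A : LG G} {v : A.V} {g : G} : g ∈ A.pi v ↔ A.Reach v v g := Iff.rfl

structure Mor (A A' : LG G) where
  ρ : A.V → A'.V
  γ : A.V → G
  hv : ∀ v, ∀ h ∈ A.H v, A'.Reach (ρ v) (ρ v) (γ v * h * (γ v)⁻¹)
  he : ∀ e, A'.Reach (ρ (A.src e)) (ρ (A.tgt e)) (γ (A.src e) * A.lab e * (γ (A.tgt e))⁻¹)

theorem Mor.half {A A' : LG G} (m : Mor A A') (η : A.E × Bool) :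
    A'.Reach (m.ρ (A.hs η)) (m.ρ (A.ht η)) (m.γ (A.hs η) * A.hl η * (m.γ (A.ht η))⁻¹) := by
  obtain ⟨e, b⟩ := η
  cases b
  · have := (m.he e).symm
    simp only [hs, ht, hl, cond_false]
    convert this using 1
    group
  · exact m.he e

theorem Mor.reach {A A' : LG G} (m : Mor A A') {u v : A.V} {g : G} (h : A.Reach u v g) :
    A'.Reach (m.ρ u) (m.ρ v) (m.γ u * g * (m.γ v)⁻¹) := by
  induction h with
  | refl => simpa using Reach.refl
  | @vert v g h _ hh ih =>
    have := ih.trans (m.hv v h hh)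
    convert this using 1
    group
  | @edge g η _ ih =>
    have := ih.trans (m.half η)
    convert this using 1
    group

def Conn (A : LG G) : Prop := ∀ u v, ∃ g, A.Reach u v g

def Rep (A : LG G) (U : Subgroup G) : Prop :=
  ∃ v g, ∀ x, x ∈ U ↔ A.Reach v v (g⁻¹ * x * g)

theorem Rep.base {A : LG G} {U : Subgroup G} (hc : A.Conn) (h : A.Rep U) (v0 : A.V) :
    ∃ g, ∀ x, x ∈ U ↔ A.Reach v0 v0 (g⁻¹ * x * g) := by
  obtain ⟨v, g, hU⟩ := h
  obtain ⟨p, hp⟩ := hc v v0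
  refine ⟨g * p, fun x => ?_⟩
  rw [hU]
  constructor
  · intro h
    have := (hp.symm.trans h).trans hp
    convert this using 1
    group
  · intro h
    have := (hp.trans h).trans hp.symm
    convert this using 1
    group

theorem rep_transfer {A A' : LG G} {U : Subgroup G} (hc : A.Conn) (hr : A.Rep U)
    (m : Mor A A') (m' : Mor A' A) (v0 : A.V) (h1 : m'.ρ (m.ρ v0) = v0)
    (h2 : m'.γ (m.ρ v0) * m.γ v0 = 1) : A'.Rep U := by
  obtain ⟨g, hg⟩ := hr.base hc v0
  have e : m'.γ (m.ρ v0) = (m.γ v0)⁻¹ := eq_inv_of_mul_eq_one_left h2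
  refine ⟨m.ρ v0, g * (m.γ v0)⁻¹, fun x => ?_⟩
  rw [hg]
  constructor
  · intro h
    convert m.reach h using 1
    group
  · intro h
    have := m'.reach h
    rw [h1, e] at this
    convert this using 1
    group

def L (A : LG G) (len : G → ℕ) : ℕ := ∑ e, len (A.lab e)

def nz (n : ℕ) : ℕ := if n = 0 then 0 else 1

def IsGen (H : Subgroup G) (r : ℕ) : Prop :=
  ∃ T : Finset G, T.card ≤ r ∧ Subgroup.closure (T : Set G) = H

theorem IsGen.zero {H : Subgroup G} (h : IsGen H 0) : H = ⊥ := by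
  obtain ⟨T, hT, rfl⟩ := h
  have : T = ∅ := Finset.card_eq_zero.1 (Nat.le_zero.1 hT)
  simp [this]

theorem IsGen.sup {H H' : Subgroup G} {r r' : ℕ} (h : IsGen H r) (h' : IsGen H' r') :
    IsGen (H ⊔ H') (r + r') := by
  classical
  obtain ⟨T, hT, rfl⟩ := h
  obtain ⟨T', hT', rfl⟩ := h'
  refine ⟨T ∪ T', (Finset.card_union_le _ _).trans (by omega), ?_⟩
  rw [Finset.coe_union, Subgroup.closure_union]

theorem IsGen.map {H : Subgroup G} {r : ℕ} (h : IsGen H r) (f : G →* G) : IsGen (H.map f) r := by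
  classical
  obtain ⟨T, hT, rfl⟩ := h
  refine ⟨T.image f, Finset.card_image_le.trans hT, ?_⟩
  rw [MonoidHom.map_closure, Finset.coe_image]

/-- the class of labelled graphs over which we minimise -/
structure InCl (A : LG G) (l c : ℕ) (LL : Set (Subgroup G)) : Prop where
  conn : A.Conn
  gen : ∀ v, IsGen (A.H v) (A.r v)
  mem : ∀ v, A.r v = 0 ∨ A.H v ∈ LL
  rank : ∑ v, A.r v + Fintype.card A.E ≤ l + Fintype.card A.V
  cplx : 2 * Fintype.card A.E + ∑ v, nz (A.r v) + 3 ≤ c + 2 * Fintype.card A.V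

/-! ### Contraction of a non-loop edge -/

open Classical in
def cρ (A : LG G) (η : A.E × Bool) (hne : A.hs η ≠ A.ht η) (x : A.V) : {x // x ≠ A.ht η} :=
  if h : x = A.ht η then ⟨A.hs η, hne⟩ else ⟨x, h⟩

open Classical in
def cγ (A : LG G) (η : A.E × Bool) (x : A.V) : G :=
  if x = A.ht η then A.hl η else 1

open Classical in
def contract (A : LG G) (η : A.E × Bool) (hne : A.hs η ≠ A.ht η) : LG G where
  V := {x // x ≠ A.ht η}
  E := {e // e ≠ η.1}
  fV := inferInstance
  fE := inferInstance
  H x := if x.1 = A.hs η then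
    A.H (A.hs η) ⊔ (A.H (A.ht η)).map (MulAut.conj (A.hl η)).toMonoidHom else A.H x.1
  r x := A.r x.1 + if x.1 = A.hs η then A.r (A.ht η) else 0
  src e := A.cρ η hne (A.src e.1)
  tgt e := A.cρ η hne (A.tgt e.1)
  lab e := A.cγ η (A.src e.1) * A.lab e.1 * (A.cγ η (A.tgt e.1))⁻¹

theorem cρ_ht (A : LG G) (η : A.E × Bool) (hne) : A.cρ η hne (A.ht η) = ⟨A.hs η, hne⟩ := by
  simp [cρ]

theorem cρ_of_ne (A : LG G) (η : A.E × Bool) (hne) {x : A.V} (h : x ≠ A.ht η) :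
    A.cρ η hne x = ⟨x, h⟩ := by
  simp [cρ, h]

theorem reach_cγ (A : LG G) (η : A.E × Bool) (hne) (x : A.V) :
    A.Reach (A.cρ η hne x).1 x (A.cγ η x) := by
  by_cases h : x = A.ht η
  · subst h
    rw [cρ_ht]
    simpa [cγ] using Reach.ofHalf η
  · rw [cρ_of_ne _ _ _ h]
    simpa [cγ, h] using Reach.refl

def contractMor (A : LG G) (η : A.E × Bool) (hne) : Mor A (A.contract η hne) where
  ρ := A.cρ η hne
  γ := A.cγ η
  hv v h hh := by
    apply Reach.ofVert
    by_cases hv : v = A.ht η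
    · subst hv
      rw [cρ_ht]
      simp only [contract, cγ, if_true]
      apply Subgroup.mem_sup_right
      exact ⟨h, hh, by simp⟩
    · rw [cρ_of_ne _ _ _ hv]
      simp only [contract, cγ, hv, if_false]
      split_ifs with h'
      · apply Subgroup.mem_sup_left
        rw [← h']; simpa using hh
      · simpa using hh
  he e := by
    by_cases h : e = η.1
    · have key : (A.cρ η hne (A.src e) = A.cρ η hne (A.tgt e)) ∧
          A.cγ η (A.src e) * A.lab e * (A.cγ η (A.tgt e))⁻¹ = 1 := by
        obtain ⟨e', b⟩ := η
        simp only at h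
        subst h
        cases b
        · have hne' : A.tgt e ≠ A.src e := hne
          constructor
          · exact (A.cρ_ht (e, false) hne).trans
              (A.cρ_of_ne (e, false) hne (x := A.tgt e) hne).symm
          · simp [cγ, ht, hl, hne']
        · have hne' : A.src e ≠ A.tgt e := hne
          constructor
          · exact (A.cρ_of_ne (e, true) hne (x := A.src e) hne).trans
              (A.cρ_ht (e, true) hne).symm
          · simp [cγ, ht, hl, hne']
      rw [key.1, key.2]
      exact Reach.refl
    · exact Reach.ofEdge (A := A.contract η hne) ⟨e, h⟩

def contractMor' (A : LG G) (η : A.E × Bool) (hne) : Mor (A.contract η hne) A where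
  ρ x := x.1
  γ _ := 1
  hv v h hh := by
    simp only [inv_one, one_mul, mul_one]
    simp only [contract] at hh
    split_ifs at hh with h'
    · have : A.H (A.hs η) ⊔ (A.H (A.ht η)).map (MulAut.conj (A.hl η)).toMonoidHom ≤ A.pi v.1 := by
        rw [h']
        apply sup_le
        · intro x hx; exact Reach.ofVert hx
        · rintro _ ⟨x, hx, rfl⟩
          have := ((Reach.ofHalf (A := A) η).trans (Reach.ofVert hx)).trans
            (Reach.ofHalf (A := A) η).symm
          exact this
      exact this hh
    · exact Reach.ofVert hh
  he e := by
    simp only [inv_one, one_mul, mul_one]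
    exact ((A.reach_cγ η hne _).trans (Reach.ofEdge e.1)).trans (A.reach_cγ η hne _).symm

theorem contract_conn {A : LG G} (hA : A.Conn) (η : A.E × Bool) (hne) :
    (A.contract η hne).Conn := by
  intro u v
  obtain ⟨g, hg⟩ := hA u.1 v.1
  have := (A.contractMor η hne).reach hg
  have e : ∀ x : (A.contract η hne).V, (A.contractMor η hne).ρ x.1 = x :=
    fun x => A.cρ_of_ne η hne x.2
  rw [e, e] at this
  exact ⟨_, this⟩

theorem contract_rep {A : LG G} {U : Subgroup G} (hA : A.Conn) (hr : A.Rep U)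
    (η : A.E × Bool) (hne) : (A.contract η hne).Rep U := by
  refine rep_transfer hA hr (A.contractMor η hne) (A.contractMor' η hne) (A.hs η) ?_ ?_
  · show (A.cρ η hne (A.hs η)).1 = _
    rw [cρ_of_ne _ _ _ hne]
  · simp [contractMor, contractMor', cγ, hne]

theorem contract_cardV {A : LG G} (η : A.E × Bool) (hne) :
    Fintype.card (A.contract η hne).V + 1 = Fintype.card A.V := by
  classical
  have h1 : Fintype.card (A.contract η hne).V = Fintype.card {x // x ≠ A.ht η} :=
    Fintype.card_congr (Equiv.refl _)
  rw [h1, Fintype.card_subtype_compl, Fintype.card_subtype_eq]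
  have := Fintype.card_pos_iff.2 ⟨A.ht η⟩
  omega

theorem contract_cardE {A : LG G} (η : A.E × Bool) (hne) :
    Fintype.card (A.contract η hne).E + 1 = Fintype.card A.E := by
  classical
  have h1 : Fintype.card (A.contract η hne).E = Fintype.card {x // x ≠ η.1} :=
    Fintype.card_congr (Equiv.refl _)
  rw [h1, Fintype.card_subtype_compl, Fintype.card_subtype_eq]
  have := Fintype.card_pos_iff.2 ⟨η.1⟩
  omega

def cmk (A : LG G) (η : A.E × Bool) (hne) : (A.contract η hne).V := ⟨A.hs η, hne⟩

theorem sum_aux {V : Type} [Fintype V] (z v : V) (hvz : v ≠ z) [Fintype {x // x ≠ z}]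
    (f : V → ℕ) (f' : {x // x ≠ z} → ℕ) (k : ℕ) (h1 : f' ⟨v, hvz⟩ + k = f v + f z)
    (h2 : ∀ x : {x // x ≠ z}, x.1 ≠ v → f' x = f x.1) :
    ∑ x, f' x + k = ∑ x, f x := by
  classical
  have e1 := Fintype.sum_eq_add_sum_subtype_ne f z
  have e2 := Fintype.sum_eq_add_sum_subtype_ne f' ⟨v, hvz⟩
  have e3 := Fintype.sum_eq_add_sum_subtype_ne (fun x : {x // x ≠ z} => f x.1) ⟨v, hvz⟩
  have e4 : ∑ i : {i : {x // x ≠ z} // i ≠ ⟨v, hvz⟩}, f' i.1 =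
      ∑ i : {i : {x // x ≠ z} // i ≠ ⟨v, hvz⟩}, f i.1.1 := by
    apply Finset.sum_congr rfl
    intro i _
    apply h2
    intro h
    exact i.2 (Subtype.ext h)
  simp only at e3
  have e5 : ∑ x : {x // x ≠ z}, f x.1 =  ∑ x : {x // x ≠ z}, f x.1 := rfl
  rw [e1]
  have e6 : ∑ x : {x // x ≠ z}, f x.1 + f' ⟨v, hvz⟩ = ∑ x, f' x + f v := by
    rw [e2, e3, e4]; ring
  have e7 : (∑ x ∈ @Finset.univ {x // x ≠ z} (Subtype.fintype _), f x.1) =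
     ∑ x : {x // x ≠ z}, f x.1 := by
    congr!
  rw [e7]
  omega

theorem contract_sum {A : LG G} (η : A.E × Bool) (hne) (f : A.V → ℕ) (f' : (A.contract η hne).V → ℕ)
    (k : ℕ) (h1 : f' (A.cmk η hne) + k = f (A.hs η) + f (A.ht η))
    (h2 : ∀ x : (A.contract η hne).V, x.1 ≠ A.hs η → f' x = f x.1) :
    ∑ x, f' x + k = ∑ x, f x :=
  @sum_aux _ _ (A.ht η) (A.hs η) hne (A.contract η hne).fV f f' k h1 h2

open Classical in
theorem contract_r {A : LG G} (η : A.E × Bool) (hne) (x : (A.contract η hne).V) :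
    (A.contract η hne).r x = A.r x.1 + if x.1 = A.hs η then A.r (A.ht η) else 0 := by
  simp [contract]

theorem contract_r1 {A : LG G} (η : A.E × Bool) (hne) :
    (A.contract η hne).r (A.cmk η hne) = A.r (A.hs η) + A.r (A.ht η) := by
  simp [contract, cmk]

theorem contract_sum_r {A : LG G} (η : A.E × Bool) (hne) :
    ∑ x, (A.contract η hne).r x = ∑ x, A.r x := by
  have := contract_sum η hne A.r (A.contract η hne).r 0 ?_ ?_
  · simpa using this
  · rw [contract_r1]; simp
  · intro x hx; rw [contract_r]; simp [hx]

theorem contract_gen {A : LG G} (hgen : ∀ v, IsGen (A.H v) (A.r v)) (η : A.E × Bool) (hne) (x) :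
    IsGen ((A.contract η hne).H x) ((A.contract η hne).r x) := by
  rw [contract_r]
  simp only [contract]
  split_ifs with h
  · rw [h]; exact (hgen _).sup ((hgen _).map _)
  · exact hgen _

/-- contracting a trivial vertex -/
theorem contract_triv {A : LG G} {l c : ℕ} {LL : Set (Subgroup G)} (hA : A.InCl l c LL)
    (η : A.E × Bool) (hne) (hz : A.r (A.ht η) = 0) : (A.contract η hne).InCl l c LL where
  conn := contract_conn hA.conn η hne
  gen := contract_gen hA.gen η hne
  mem x := by
    rw [contract_r, hz]
    simp only [contract]
    have hb : A.H (A.ht η) = ⊥ := by have := hA.gen (A.ht η); rw [hz] at this; exact this.zero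
    rw [hb]
    have := hA.mem x.1
    split_ifs with h
    · simpa [← h] using this
    · simpa using this
  rank := by
    have := hA.rank
    have := contract_sum_r (A := A) η hne
    have := contract_cardV (A := A) η hne
    have := contract_cardE (A := A) η hne
    omega
  cplx := by
    have := hA.cplx
    have h := contract_sum η hne (fun x => nz (A.r x)) (fun x => nz ((A.contract η hne).r x)) 0 ?_ ?_
    · have := contract_cardV (A := A) η hne
      have := contract_cardE (A := A) η hne
      omega
    · simp only [contract_r1]; simp [hz, nz]
    · intro x hx; rw [contract_r]; simp [hx]

/-- merging two nontrivial vertices -/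
theorem contract_merge {A : LG G} {l c : ℕ} {LL LL' : Set (Subgroup G)} (hA : A.InCl l (c + 1) LL)
    (η : A.E × Bool) (hne) (hz : A.r (A.ht η) ≠ 0) (hv : A.r (A.hs η) ≠ 0) (hLL : LL ⊆ LL')
    (hmem : A.H (A.hs η) ⊔ (A.H (A.ht η)).map (MulAut.conj (A.hl η)).toMonoidHom ∈ LL') :
    (A.contract η hne).InCl l c LL' where
  conn := contract_conn hA.conn η hne
  gen := contract_gen hA.gen η hne
  mem x := by
    rw [contract_r]
    simp only [contract]
    split_ifs with h
    · right; exact hmem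
    · rcases hA.mem x.1 with h | h
      · left; simpa using h
      · right; exact hLL h
  rank := by
    have := hA.rank
    have := contract_sum_r (A := A) η hne
    have := contract_cardV (A := A) η hne
    have := contract_cardE (A := A) η hne
    omega
  cplx := by
    have := hA.cplx
    have h := contract_sum η hne (fun x => nz (A.r x)) (fun x => nz ((A.contract η hne).r x)) 1 ?_ ?_
    · have := contract_cardV (A := A) η hne
      have := contract_cardE (A := A) η hne
      omega
    · simp only [contract_r1]; simp [hz, hv, nz]
    · intro x hx; rw [contract_r]; simp [hx]

open Classical in
def val (A : LG G) (z : A.V) : ℕ :=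
  ∑ e : A.E, ((if A.src e = z then 1 else 0) + (if A.tgt e = z then 1 else 0))

theorem contract_L {A : LG G} {len : G → ℕ} {D : ℕ} (hG : Geo len D) (η : A.E × Bool) (hne) :
    (A.contract η hne).L len + 2 * len (A.hl η) ≤ A.L len + A.val (A.ht η) * len (A.hl η) := by
  classical
  unfold L val
  rw [Fintype.sum_eq_add_sum_subtype_ne (fun e => len (A.lab e)) η.1,
    Fintype.sum_eq_add_sum_subtype_ne _ η.1, add_mul, Finset.sum_mul]
  have h1 : len (A.lab η.1) = len (A.hl η) := by
    obtain ⟨e, b⟩ := η; cases b <;> simp [hl, hG.inv]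
  have h2 : 1 ≤ ((if A.src η.1 = A.ht η then 1 else 0) + if A.tgt η.1 = A.ht η then 1 else 0) := by
    obtain ⟨e, b⟩ := η; cases b <;> simp [ht]
  have h3 : ∀ x, len (A.cγ η x) = (if x = A.ht η then 1 else 0) * len (A.hl η) := by
    intro x; unfold cγ; split_ifs <;> simp [hG.one]
  have h4 : ∑ e : (A.contract η hne).E, len ((A.contract η hne).lab e) ≤
     ∑ i : {i // i ≠ η.1}, (len (A.lab i.1) + ((if A.src i.1 = A.ht η then 1 else 0) +
      if A.tgt i.1 = A.ht η then 1 else 0) * len (A.hl η)) := by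
    have : ∑ e : (A.contract η hne).E, len ((A.contract η hne).lab e) =
        ∑ i : {i // i ≠ η.1}, len (A.cγ η (A.src i.1) * A.lab i.1 * (A.cγ η (A.tgt i.1))⁻¹) := by
      apply Fintype.sum_equiv (Equiv.refl _); intro x; rfl
    rw [this]
    apply Finset.sum_le_sum
    intro i _
    have a1 := hG.mul (A.cγ η (A.src i.1) * A.lab i.1) (A.cγ η (A.tgt i.1))⁻¹
    have a2 := hG.mul (A.cγ η (A.src i.1)) (A.lab i.1)
    rw [hG.inv, h3] at a1
    rw [h3] at a2
    rw [add_mul]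
    omega
  rw [Finset.sum_add_distrib] at h4
  have h5 := Nat.mul_le_mul_right (len (A.hl η)) h2
  rw [one_mul] at h5
  omega

end LG

end KWP

namespace KWP

open KW


namespace LG

variable {G : Type u} [Group G]

/-! ### Absorbing a loop -/

open Classical in
def absorb (A : LG G) (f : A.E) : LG G where
  V := A.V
  E := {e // e ≠ f}
  fV := A.fV
  fE := inferInstance
  H x := if x = A.src f then A.H x ⊔ Subgroup.zpowers (A.lab f) else A.H x
  r x := A.r x + if x = A.src f then 1 else 0
  src e := A.src e.1
  tgt e := A.tgt e.1
  lab e := A.lab e.1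

def absorbMor (A : LG G) (f : A.E) (hf : A.src f = A.tgt f) : Mor A (A.absorb f) where
  ρ x := x
  γ _ := 1
  hv v h hh := by
    simp only [inv_one, one_mul, mul_one]
    apply Reach.ofVert
    simp only [absorb]
    split_ifs with h'
    · exact Subgroup.mem_sup_left hh
    · exact hh
  he e := by
    simp only [inv_one, one_mul, mul_one]
    by_cases h : e = f
    · subst h
      rw [← hf]
      apply Reach.ofVert
      simp only [absorb, if_true]
      exact Subgroup.mem_sup_right (Subgroup.mem_zpowers _)
    · exact Reach.ofEdge (A := A.absorb f) ⟨e, h⟩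

def absorbMor' (A : LG G) (f : A.E) (hf : A.src f = A.tgt f) : Mor (A.absorb f) A where
  ρ x := x
  γ _ := 1
  hv v h hh := by
    simp only [inv_one, one_mul, mul_one]
    simp only [absorb] at hh
    split_ifs at hh with h'
    · have : A.H v ⊔ Subgroup.zpowers (A.lab f) ≤ A.pi v := by
        apply sup_le
        · intro x hx; exact Reach.ofVert hx
        · rw [Subgroup.zpowers_le]
          have := Reach.ofEdge f
          rw [← hf] at this
          rw [h']
          exact this
      exact this hh
    · exact Reach.ofVert hh
  he e := by
    simp only [inv_one, one_mul, mul_one]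
    exact Reach.ofEdge e.1

theorem absorb_conn {A : LG G} (hA : A.Conn) (f : A.E) (hf : A.src f = A.tgt f) :
    (A.absorb f).Conn := by
  intro u v
  obtain ⟨g, hg⟩ := hA u v
  exact ⟨_, (A.absorbMor f hf).reach hg⟩

theorem absorb_rep {A : LG G} {U : Subgroup G} (hA : A.Conn) (hr : A.Rep U)
    (f : A.E) (hf : A.src f = A.tgt f) : (A.absorb f).Rep U := by
  refine rep_transfer hA hr (A.absorbMor f hf) (A.absorbMor' f hf) (A.src f) rfl ?_
  simp [absorbMor, absorbMor']

theorem absorb_cardE {A : LG G} (f : A.E) :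
    Fintype.card (A.absorb f).E + 1 = Fintype.card A.E := by
  classical
  have h1 : Fintype.card (A.absorb f).E = Fintype.card {x // x ≠ f} :=
    Fintype.card_congr (Equiv.refl _)
  rw [h1, Fintype.card_subtype_compl, Fintype.card_subtype_eq]
  have := Fintype.card_pos_iff.2 ⟨f⟩
  omega

theorem absorb_cardV {A : LG G} (f : A.E) :
    Fintype.card (A.absorb f).V = Fintype.card A.V := rfl

open Classical in
theorem absorb_r {A : LG G} (f : A.E) (x : A.V) :
    (A.absorb f).r x = A.r x + if x = A.src f then 1 else 0 := rfl

theorem absorb_sum_r {A : LG G} (f : A.E) :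
    ∑ x, (A.absorb f).r x = ∑ x, A.r x + 1 := by
  classical
  show ∑ x : A.V, (A.r x + if x = A.src f then 1 else 0) = _
  rw [Finset.sum_add_distrib]
  simp

theorem nz_add (a b : ℕ) : nz (a + b) ≤ nz a + b := by
  unfold nz; split_ifs <;> omega

theorem absorb_sum_nz {A : LG G} (f : A.E) :
    ∑ x, nz ((A.absorb f).r x) ≤ ∑ x, nz (A.r x) + 1 := by
  classical
  show ∑ x : A.V, nz (A.r x + if x = A.src f then 1 else 0) ≤ _
  have : ∑ x : A.V, nz (A.r x + if x = A.src f then 1 else 0) ≤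
     ∑ x : A.V, (nz (A.r x) + if x = A.src f then 1 else 0) :=
    Finset.sum_le_sum fun x _ => nz_add _ _
  rw [Finset.sum_add_distrib] at this
  simp only [Finset.sum_ite_eq', Finset.mem_univ, if_true] at this
  exact this

theorem isGen_zpowers (g : G) : IsGen (Subgroup.zpowers g) 1 :=
  ⟨{g}, by simp, by rw [Subgroup.zpowers_eq_closure]; simp⟩

theorem absorb_gen {A : LG G} (hgen : ∀ v, IsGen (A.H v) (A.r v)) (f : A.E) (x) :
    IsGen ((A.absorb f).H x) ((A.absorb f).r x) := by
  simp only [absorb]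
  split_ifs with h
  · exact (hgen _).sup (isGen_zpowers _)
  · exact hgen _

theorem absorb_cl {A : LG G} {l c : ℕ} {LL LL' : Set (Subgroup G)} (hA : A.InCl l (c + 1) LL)
    (f : A.E) (hf : A.src f = A.tgt f) (hLL : LL ⊆ LL')
    (hmem : A.H (A.src f) ⊔ Subgroup.zpowers (A.lab f) ∈ LL') :
    (A.absorb f).InCl l c LL' where
  conn := absorb_conn hA.conn f hf
  gen := absorb_gen hA.gen f
  mem x := by
    simp only [absorb]
    split_ifs with h
    · right; rw [h]; exact hmem
    · rcases hA.mem x with h | h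
      · left; simpa using h
      · right; exact hLL h
  rank := by
    have := hA.rank
    have := absorb_sum_r (A := A) f
    have := absorb_cardV (A := A) f
    have := absorb_cardE (A := A) f
    omega
  cplx := by
    have := hA.cplx
    have := absorb_sum_nz (A := A) f
    have := absorb_cardV (A := A) f
    have := absorb_cardE (A := A) f
    omega

/-! ### Combinatorics -/

theorem exists_nonloop {A : LG G} (hc : A.Conn) {u v : A.V} (huv : u ≠ v) :
    ∃ η, A.ht η = u ∧ A.hs η ≠ u := by
  by_contra hcon
  push Not at hcon
  obtain ⟨g, hg⟩ := hc v u
  apply huv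
  have : ∀ w g, A.Reach u w g → w = u := by
    intro w g h
    induction h with
    | refl => rfl
    | vert _ _ ih => exact ih
    | edge η _ ih =>
      have := hcon (rv η)
      rw [ht_rv, hs_rv] at this
      exact this ih
  exact (this _ _ hg.symm).symm

theorem card_V_le : ∀ (n : ℕ) (A : LG G), A.Conn → Fintype.card A.E = n → Fintype.card A.V ≤ n + 1 := by
  intro n
  induction n with
  | zero =>
    intro A hc hE
    by_contra h
    push Not at h
    obtain ⟨u, v, huv⟩ := Fintype.one_lt_card_iff.1 (by omega : 1 < Fintype.card A.V)
    obtain ⟨η, _⟩ := exists_nonloop hc huv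
    have := Fintype.card_pos_iff.2 ⟨η.1⟩
    omega
  | succ n ih =>
    intro A hc hE
    by_contra h
    push Not at h
    obtain ⟨u, v, huv⟩ := Fintype.one_lt_card_iff.1 (by omega : 1 < Fintype.card A.V)
    obtain ⟨η, h1, h2⟩ := exists_nonloop hc huv
    have hne : A.hs η ≠ A.ht η := by rw [h1]; exact h2
    have a1 := contract_cardV (A := A) η hne
    have a2 := contract_cardE (A := A) η hne
    have := ih (A.contract η hne) (contract_conn hc η hne) (by omega)
    omega

theorem no_cl_zero {A : LG G} {l : ℕ} {LL : Set (Subgroup G)} (hA : A.InCl l 0 LL) : False := by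
  have := hA.cplx
  have := card_V_le _ A hA.conn rfl
  omega

def CJ (U H : Subgroup G) : Prop := ∃ g, Subgroup.map (MulAut.conj g).toMonoidHom H = U

theorem cj_of {U H : Subgroup G} (g : G) (h : ∀ x, x ∈ U ↔ g⁻¹ * x * g ∈ H) : CJ U H := by
  refine ⟨g, ?_⟩
  ext x
  rw [h]
  constructor
  · rintro ⟨y, hy, rfl⟩
    simpa [mul_assoc] using hy
  · intro hx
    exact ⟨_, hx, by simp [mul_assoc]⟩

theorem rep_noedge {A : LG G} {U : Subgroup G} (hr : A.Rep U) (hE : Fintype.card A.E = 0) :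
    ∃ v, CJ U (A.H v) := by
  have hemp := Fintype.card_eq_zero_iff.1 hE
  obtain ⟨v, g, h⟩ := hr
  refine ⟨v, cj_of g fun x => ?_⟩
  rw [h]
  constructor
  · intro hx
    have : ∀ w g, A.Reach v w g → w = v ∧ g ∈ A.H v := by
      intro w g h
      induction h with
      | refl => exact ⟨rfl, one_mem _⟩
      | vert _ hh ih => obtain ⟨rfl, h⟩ := ih; exact ⟨rfl, mul_mem h hh⟩
      | edge η => exact (hemp.false η.1).elim
    exact (this _ _ hx).2
  · exact Reach.ofVert

theorem big_rank {U : Subgroup G} {l c : ℕ} {LL : Set (Subgroup G)} : ∀ (n : ℕ) (A : LG G),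
    A.InCl l c LL → A.Rep U → Fintype.card A.E = n → (∃ v, l + 1 ≤ A.r v) → ∃ H ∈ LL, CJ U H := by
  classical
  intro n
  induction n with
  | zero =>
    rintro A hA hr hE ⟨v, hv⟩
    obtain ⟨w, hw⟩ := rep_noedge hr hE
    have h1 := card_V_le _ A hA.conn hE
    have : w = v := Fintype.card_le_one_iff.1 h1 w v
    subst this
    rcases hA.mem w with h | h
    · omega
    · exact ⟨_, h, hw⟩
  | succ n ih =>
    rintro A hA hr hE ⟨v, hv⟩
    have h0 := hA.rank
    have hs0 : A.r v ≤ ∑ x, A.r x :=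
      Finset.single_le_sum (f := A.r) (fun i _ => Nat.zero_le _) (Finset.mem_univ v)
    have hs1 : ∀ x, x ≠ v → A.r v + A.r x ≤ ∑ x, A.r x := by
      intro x hx
      have := Finset.sum_le_univ_sum_of_nonneg (s := {v, x}) (fun i => Nat.zero_le (A.r i))
      rw [Finset.sum_pair hx.symm] at this
      exact this
    have h1 := card_V_le _ A hA.conn hE
    have hcard : 1 < Fintype.card A.V := by omega
    have hz : ∀ x, x ≠ v → A.r x = 0 := by
      intro x hx; have := hs1 x hx; omega
    obtain ⟨u, huv⟩ := Fintype.exists_ne_of_one_lt_card hcard v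
    obtain ⟨η, h3, h4⟩ := exists_nonloop hA.conn huv
    have hne : A.hs η ≠ A.ht η := by rw [h3]; exact h4
    have a2 := contract_cardE (A := A) η hne
    refine ih (A.contract η hne) (contract_triv hA η hne ?_) (contract_rep hA.conn hr η hne)
      (by omega) ⟨⟨v, ?_⟩, ?_⟩
    · rw [h3]; exact hz u huv
    · rw [h3]; exact huv.symm
    · exact hv.trans (Nat.le_add_right _ _)

theorem sum_val (A : LG G) : ∑ z, A.val z = 2 * Fintype.card A.E := by
  classical
  unfold val
  rw [Finset.sum_comm]
  simp only [Finset.sum_add_distrib]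
  simp
  ring

theorem edge_bound {len : G → ℕ} {D : ℕ} (hG : Geo len D) {U : Subgroup G} {l c : ℕ}
    {LL : Set (Subgroup G)} : ∀ (n : ℕ) (A : LG G), Fintype.card A.E = n →
    A.InCl l c LL → A.Rep U → ∃ A' : LG G, A'.InCl l c LL ∧ A'.Rep U ∧ A'.L len ≤ A.L len ∧
      Fintype.card A'.E ≤ 3 * c := by
  intro n
  induction n with
  | zero => intro A hE hA hr; exact ⟨A, hA, hr, le_rfl, by omega⟩
  | succ n ih =>
    intro A hE hA hr
    by_cases hsmall : Fintype.card A.E ≤ 3 * c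
    · exact ⟨A, hA, hr, le_rfl, hsmall⟩
    have h1 := hA.cplx
    have h2 := card_V_le _ A hA.conn rfl
    have hcard : 1 < Fintype.card A.V := by omega
    have : ∃ z, A.r z = 0 ∧ A.val z ≤ 2 := by
      by_contra hcon
      push Not at hcon
      have h3 : ∑ z : A.V, 3 ≤ ∑ z : A.V, (A.val z + 3 * nz (A.r z)) := by
        apply Finset.sum_le_sum
        intro z _
        by_cases hz : A.r z = 0
        · have := hcon z hz; omega
        · simp [nz, hz]
      rw [Finset.sum_add_distrib, ← Finset.mul_sum, sum_val] at h3
      simp only [Finset.sum_const, Finset.card_univ, smul_eq_mul] at h3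
      omega
    obtain ⟨z, hz0, hz⟩ := this
    obtain ⟨u, huv⟩ := Fintype.exists_ne_of_one_lt_card hcard z
    obtain ⟨η, h3, h4⟩ := exists_nonloop hA.conn huv.symm
    have hne : A.hs η ≠ A.ht η := by rw [h3]; exact h4
    have a2 := contract_cardE (A := A) η hne
    obtain ⟨A', b1, b2, b3, b4⟩ := ih (A.contract η hne) (by omega)
      (contract_triv hA η hne (by rw [h3]; exact hz0)) (contract_rep hA.conn hr η hne)
    refine ⟨A', b1, b2, b3.trans ?_, b4⟩
    have := contract_L hG η hne
    rw [h3] at this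
    have := Nat.mul_le_mul_right (len (A.hl η)) hz
    omega

end LG

end KWP

namespace KWP

open KW


namespace LG

variable {G : Type u} [Group G]

/-! ### Reduced paths -/

inductive RP (A : LG G) (u : A.V) : A.E × Bool → G → Prop
  | start (η h) : A.hs η = u → h ∈ A.H u → RP A u η (h * A.hl η)
  | step (η η' g h) : RP A u η g → h ∈ A.H (A.ht η) → A.hs η' = A.ht η → (η' = rv η → h ≠ 1) →
      RP A u η' (g * h * A.hl η')

theorem RP.inv {A : LG G} {u : A.V} {η : A.E × Bool} {g : G} (h : RP A u η g) :
    ∃ g0, g = g0 * A.hl η ∧ ((A.hs η = u ∧ g0 ∈ A.H u) ∨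
      ∃ η1 g1 h1, RP A u η1 g1 ∧ A.ht η1 = A.hs η ∧ h1 ∈ A.H (A.ht η1) ∧ g0 = g1 * h1) := by
  cases h with
  | start _ h h1 h2 => exact ⟨h, rfl, Or.inl ⟨h1, h2⟩⟩
  | step η1 _ g1 h1 a b c d => exact ⟨_, rfl, Or.inr ⟨η1, g1, h1, a, c.symm, b, rfl⟩⟩

theorem reach_decomp {A : LG G} {u w : A.V} {g : G} (h : A.Reach u w g) :
    (u = w ∧ g ∈ A.H u) ∨ ∃ η g' h, RP A u η g' ∧ A.ht η = w ∧ h ∈ A.H w ∧ g = g' * h := by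
  induction h with
  | refl => exact Or.inl ⟨rfl, one_mem _⟩
  | vert _ hh ih =>
    rcases ih with ⟨rfl, h⟩ | ⟨η, g', h, a, b, c, rfl⟩
    · exact Or.inl ⟨rfl, mul_mem h hh⟩
    · exact Or.inr ⟨η, g', _, a, b, mul_mem c hh, by rw [mul_assoc]⟩
  | edge η' _ ih =>
    rcases ih with ⟨h1, h⟩ | ⟨η, g', h, a, b, c, rfl⟩
    · exact Or.inr ⟨η', _, 1, RP.start η' _ h1.symm h, rfl, one_mem _, by simp⟩
    · by_cases hcan : η' = rv η ∧ h = 1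
      · obtain ⟨rfl, rfl⟩ := hcan
        obtain ⟨g0, rfl, h0⟩ := a.inv
        rw [hl_rv, ht_rv]
        simp only [mul_one, mul_inv_cancel_right]
        rcases h0 with ⟨h1, h2⟩ | ⟨η1, g1, h1, a1, a2, a3, a4⟩
        · exact Or.inl ⟨h1.symm, h2⟩
        · exact Or.inr ⟨η1, g1, h1, a1, a2, a2 ▸ a3, a4⟩
      · refine Or.inr ⟨η', _, 1, RP.step η η' g' h a (b ▸ c) b.symm ?_, rfl, one_mem _, by simp⟩
        intro h1 h2
        exact hcan ⟨h1, h2⟩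

theorem Reach.congr {A : LG G} {u v : A.V} {g g' : G} (h : A.Reach u v g) (e : g = g') :
    A.Reach u v g' := e ▸ h

/-! ### Lifts to `G × M` and freeness -/

structure Lift (A : LG G) (M : Type u) [Group M] where
  K : A.V → Subgroup (G × M)
  τ : A.E → M
  sub : ∀ v p, p ∈ K v → p.1 ∈ A.H v
  inj : ∀ v m, ((1 : G), m) ∈ K v → m = 1
  surj : ∀ v, ∀ h ∈ A.H v, ∃ m, (h, m) ∈ K v

variable {M : Type u} [Group M]

def Lift.lg {A : LG G} (d : Lift A M) : LG (G × M) where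
  V := A.V
  E := A.E
  fV := A.fV
  fE := A.fE
  H := d.K
  r := A.r
  src := A.src
  tgt := A.tgt
  lab e := (A.lab e, d.τ e)

theorem Lift.uniq {A : LG G} (d : Lift A M) {v : A.V} {g : G} {m m' : M} (h : (g, m) ∈ d.K v)
    (h' : (g, m') ∈ d.K v) : m = m' := by
  have := mul_mem (inv_mem h) h'
  simp only [Prod.inv_mk, Prod.mk_mul_mk, inv_mul_cancel] at this
  have := d.inj _ _ this
  exact inv_mul_eq_one.1 this

theorem Lift.hl_fst {A : LG G} (d : Lift A M) (η : A.E × Bool) :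
    (d.lg.hl η).1 = A.hl η := by
  obtain ⟨e, b⟩ := η; cases b <;> rfl

theorem RP.congr {A : LG G} {u : A.V} {η : A.E × Bool} {g g' : G} (h : A.RP u η g) (e : g = g') :
    A.RP u η g' := e ▸ h

theorem Lift.rp {A : LG G} (d : Lift A M) {u : d.lg.V} {η : d.lg.E × Bool} {p : G × M}
    (h : RP (G := G × M) d.lg u η p) : RP A u η p.1 := by
  induction h with
  | start η h h1 h2 =>
    refine (RP.start (A := A) η h.1 h1 (d.sub _ _ h2)).congr ?_
    rw [Prod.fst_mul]
    exact congrArg _ (d.hl_fst η).symm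
  | step η η' g h a b c e ih =>
    refine (RP.step (A := A) η η' _ h.1 ih (d.sub _ _ b) c ?_).congr ?_
    rotate_left
    · rw [Prod.fst_mul, Prod.fst_mul]
      exact congrArg _ (d.hl_fst η').symm
    intro h1 h2
    apply e h1
    have b' : ((1 : G), h.2) ∈ d.K (A.ht η) := by rw [← h2]; exact b
    exact Prod.ext h2 (d.inj _ _ b')

def Free (A : LG G) : Prop :=
  ∀ (M : Type u) [Group M] (d : Lift A M) (u : A.V) (m : M), d.lg.Reach u u (1, m) → m = 1

theorem free_of_rp {A : LG G} (h : ∀ u η g h, RP A u η g → h ∈ A.H (A.ht η) → g * h ≠ 1) :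
    A.Free := by
  intro M _ d u m hm
  rcases reach_decomp hm with ⟨_, h1⟩ | ⟨η, g', k, h1, h2, h3, h4⟩
  · exact d.inj _ _ h1
  · exfalso
    have h5 := d.rp h1
    refine h u η g'.1 k.1 h5 ?_ ?_
    · have := d.sub _ _ h3
      rw [show A.ht η = u from h2]
      exact this
    · have := congrArg Prod.fst h4
      exact this.symm

theorem free_transfer {A A' : LG G} (hF : A.Free)
    (h : ∀ (M : Type u) [Group M] (d' : Lift A' M), ∃ d : Lift A M, ∃ m : Mor d'.lg d.lg,
      ∀ x, m.γ x = 1) : A'.Free := by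
  intro M _ d' u m hm
  obtain ⟨d, mor, h1⟩ := h M d'
  have := (mor.reach hm).congr (g' := (1, m)) (by rw [show mor.γ u = 1 from h1 u]; simp)
  exact hF M d _ _ this

theorem contract_memH (A : LG G) (η : A.E × Bool) (hne) (v : A.V) (h : G) (hh : h ∈ A.H v) :
    A.cγ η v * h * (A.cγ η v)⁻¹ ∈ (A.contract η hne).H (A.cρ η hne v) := by
  by_cases hv : v = A.ht η
  · subst hv
    rw [cρ_ht]
    simp only [contract, cγ, if_true]
    apply Subgroup.mem_sup_right
    exact ⟨h, hh, by simp⟩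
  · rw [cρ_of_ne _ _ _ hv]
    simp only [contract, cγ, hv, if_false]
    split_ifs with h'
    · apply Subgroup.mem_sup_left
      rw [← h']; simpa using hh
    · simpa using hh

def cK (A : LG G) (η : A.E × Bool) (hne) (d' : Lift (A.contract η hne) M) (v : A.V) :
    Subgroup (G × M) :=
  ((d'.K (A.cρ η hne v)).comap (MulAut.conj ((A.cγ η v, 1) : G × M)).toMonoidHom) ⊓
    (A.H v).comap (MonoidHom.fst G M)

open Classical in
def contractLift (A : LG G) (η : A.E × Bool) (hne) (d' : Lift (A.contract η hne) M) : Lift A M where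
  K := A.cK η hne d'
  τ e := if h : e ≠ η.1 then d'.τ ⟨e, h⟩ else 1
  sub v p hp := hp.2
  inj v m hm := by
    have := hm.1
    refine d'.inj (A.cρ η hne v) m ?_
    simpa using this
  surj v h hh := by
    obtain ⟨m, hm⟩ := d'.surj _ _ (A.contract_memH η hne v h hh)
    refine ⟨m, ?_, hh⟩
    simpa using hm

theorem contractLift_half (A : LG G) (η : A.E × Bool) (hne) (d' : Lift (A.contract η hne) M) :
    (A.contractLift η hne d').lg.Reach (A.hs η) (A.ht η) (A.hl η, 1) := by
  have := Reach.ofHalf (A := (A.contractLift η hne d').lg) η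
  refine this.congr ?_
  obtain ⟨e, b⟩ := η
  cases b
  · simp [Lift.lg, hl, contractLift]
  · simp [Lift.lg, hl, contractLift]

theorem contractLift_reach (A : LG G) (η : A.E × Bool) (hne) (d' : Lift (A.contract η hne) M)
    (x : A.V) : (A.contractLift η hne d').lg.Reach (A.cρ η hne x).1 x (A.cγ η x, 1) := by
  by_cases h : x = A.ht η
  · subst h
    rw [cρ_ht]
    simpa [cγ] using A.contractLift_half η hne d'
  · rw [cρ_of_ne _ _ _ h]
    exact Reach.refl.congr (by simp [cγ, h]; rfl)

theorem contractLift_vert (A : LG G) (η : A.E × Bool) (hne) (d' : Lift (A.contract η hne) M)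
    (v : A.V) (h : G) (hh : h ∈ A.H v) : ∃ m,
      (A.cγ η v * h * (A.cγ η v)⁻¹, m) ∈ d'.K (A.cρ η hne v) ∧
      (A.contractLift η hne d').lg.Reach (A.cρ η hne v).1 (A.cρ η hne v).1
        (A.cγ η v * h * (A.cγ η v)⁻¹, m) := by
  obtain ⟨m, hm⟩ := (A.contractLift η hne d').surj v h hh
  refine ⟨m, ?_, ?_⟩
  · have := hm.1
    simpa [MulAut.conj_apply] using this
  · have h1 := A.contractLift_reach η hne d' v
    have := (h1.trans (Reach.ofVert (A := (A.contractLift η hne d').lg) hm)).trans h1.symm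
    simpa using this

theorem free_contract {A : LG G} (hF : A.Free) (η : A.E × Bool) (hne) :
    (A.contract η hne).Free := by
  apply free_transfer hF
  intro M _ d'
  refine ⟨A.contractLift η hne d', ⟨fun x => x.1, fun _ => 1, ?_, ?_⟩, fun _ => rfl⟩
  · rintro v ⟨y, m⟩ hy
    simp only [inv_one, one_mul, mul_one]
    set T : Subgroup (G × M) := d'.K v ⊓ (A.contractLift η hne d').lg.pi v.1 with hT
    have key : (A.contract η hne).H v ≤ T.map (MonoidHom.fst G M) := by
      have k0 : ∀ w, ∀ h ∈ A.H w, A.cρ η hne w = v →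
          A.cγ η w * h * (A.cγ η w)⁻¹ ∈ T.map (MonoidHom.fst G M) := by
        intro w h hh hw
        obtain ⟨m, h1, h2⟩ := A.contractLift_vert η hne d' w h hh
        rw [hw] at h1 h2
        exact ⟨_, ⟨h1, h2⟩, rfl⟩
      have k1 : A.H v.1 ≤ T.map (MonoidHom.fst G M) := by
        intro h hh
        have := k0 v.1 h hh (A.cρ_of_ne η hne v.2)
        simpa [cγ, v.2] using this
      simp only [contract]
      split_ifs with h'
      · rw [← h']
        refine sup_le k1 ?_
        rintro _ ⟨h, hh, rfl⟩
        have := k0 (A.ht η) h hh ((A.cρ_ht η hne).trans (Subtype.ext h'.symm))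
        simpa [cγ] using this
      · exact k1
    obtain ⟨⟨y', m'⟩, h1, h2⟩ := key (d'.sub _ _ hy)
    simp only [MonoidHom.coe_fst] at h2
    subst h2
    rw [d'.uniq hy h1.1]
    exact h1.2
  · intro e
    simp only [inv_one, one_mul, mul_one]
    have h1 := A.contractLift_reach η hne d' (A.src e.1)
    have h2 := A.contractLift_reach η hne d' (A.tgt e.1)
    have h3 := (h1.trans (Reach.ofEdge (A := (A.contractLift η hne d').lg) e.1)).trans h2.symm
    refine h3.congr ?_
    have : e.1 ≠ η.1 := e.2
    simp [Lift.lg, contractLift, contract, this]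
    rfl

open Classical in
def absorbLift (A : LG G) (f : A.E) (d' : Lift (A.absorb f) M) (m0 : M) : Lift A M where
  K v := d'.K v ⊓ (A.H v).comap (MonoidHom.fst G M)
  τ e := if h : e ≠ f then d'.τ ⟨e, h⟩ else m0
  sub v p hp := hp.2
  inj v m hm := d'.inj v m hm.1
  surj v h hh := by
    have : h ∈ (A.absorb f).H v := by
      simp only [absorb]
      split_ifs with h'
      · exact Subgroup.mem_sup_left hh
      · exact hh
    obtain ⟨m, hm⟩ := d'.surj _ _ this
    exact ⟨m, hm, hh⟩

theorem free_absorb {A : LG G} (hF : A.Free) (f : A.E) (hf : A.src f = A.tgt f) :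
    (A.absorb f).Free := by
  apply free_transfer hF
  intro M _ d'
  have hmem : A.lab f ∈ (A.absorb f).H (A.src f) := by
    simp only [absorb, if_true]
    exact Subgroup.mem_sup_right (Subgroup.mem_zpowers _)
  obtain ⟨m0, hm0⟩ := d'.surj _ _ hmem
  refine ⟨A.absorbLift f d' m0, ⟨fun x => x, fun _ => 1, ?_, ?_⟩, fun _ => rfl⟩
  · rintro v ⟨y, m⟩ hy
    simp only [inv_one, one_mul, mul_one]
    set T : Subgroup (G × M) := d'.K v ⊓ (A.absorbLift f d' m0).lg.pi v with hT
    have key : (A.absorb f).H v ≤ T.map (MonoidHom.fst G M) := by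
      have k1 : A.H v ≤ T.map (MonoidHom.fst G M) := by
        intro h hh
        obtain ⟨m, hm⟩ := (A.absorbLift f d' m0).surj v h hh
        exact ⟨_, ⟨hm.1, Reach.ofVert (A := (A.absorbLift f d' m0).lg) hm⟩, rfl⟩
      simp only [absorb]
      split_ifs with h'
      · refine sup_le k1 ?_
        rw [Subgroup.zpowers_le]
        refine ⟨(A.lab f, m0), ⟨by rw [h']; exact hm0, ?_⟩, rfl⟩
        have := Reach.ofEdge (A := (A.absorbLift f d' m0).lg) f
        rw [show (A.absorbLift f d' m0).lg.tgt f = A.src f from hf.symm,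
          show (A.absorbLift f d' m0).lg.src f = A.src f from rfl,
          show (A.absorbLift f d' m0).lg.lab f = (A.lab f, m0) by simp [Lift.lg, absorbLift]] at this
        rw [h']
        exact this
      · exact k1
    obtain ⟨⟨y', m'⟩, h1, h2⟩ := key (d'.sub _ _ hy)
    simp only [MonoidHom.coe_fst] at h2
    subst h2
    rw [d'.uniq hy h1.1]
    exact h1.2
  · intro e
    simp only [inv_one, one_mul, mul_one]
    have h3 := Reach.ofEdge (A := (A.absorbLift f d' m0).lg) e.1
    refine h3.congr ?_
    have : e.1 ≠ f := e.2
    simp [Lift.lg, absorbLift, absorb, this]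
    rfl

end LG

end KWP

namespace KWP

open KW


theorem not_fi_gen {U P Q : Type u} [Group U] [Group P] [Group Q] [Nontrivial P] [Nontrivial Q]
    (f : P →* U) (f' : Q →* U) (hb : Function.Bijective (Monoid.Coprod.lift f f')) :
    ¬ FreelyIndecomposable U := by
  rintro ⟨_, hno⟩
  apply hno
  have hf : Function.Injective f := by
    have : ⇑f = (Monoid.Coprod.lift f f') ∘ Monoid.Coprod.inl := by ext; simp
    rw [this]
    exact hb.1.comp Monoid.Coprod.inl_injective
  have hf' : Function.Injective f' := by
    have : ⇑f' = (Monoid.Coprod.lift f f') ∘ Monoid.Coprod.inr := by ext; simp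
    rw [this]
    exact hb.1.comp Monoid.Coprod.inr_injective
  refine ⟨f.range, f'.range, ?_, ?_, ?_⟩
  · intro h
    obtain ⟨x, hx⟩ := exists_ne (1 : P)
    apply hx
    apply hf
    have : f x ∈ f.range := ⟨x, rfl⟩
    rw [h, Subgroup.mem_bot] at this
    simpa using this
  · intro h
    obtain ⟨x, hx⟩ := exists_ne (1 : Q)
    apply hx
    apply hf'
    have : f' x ∈ f'.range := ⟨x, rfl⟩
    rw [h, Subgroup.mem_bot] at this
    simpa using this
  · let e := MulEquiv.coprodCongr (MonoidHom.ofInjective hf) (MonoidHom.ofInjective hf')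
    have : (Monoid.Coprod.lift f.range.subtype f'.range.subtype).comp e.toMonoidHom =
        Monoid.Coprod.lift f f' := by
      apply Monoid.Coprod.hom_ext
      · ext x; simp [e]; rfl
      · ext x; simp [e]; rfl
    rw [← this] at hb
    have h2 : ⇑(Monoid.Coprod.lift f.range.subtype f'.range.subtype) =
        ((Monoid.Coprod.lift f.range.subtype f'.range.subtype).comp e.toMonoidHom) ∘ e.symm := by
      ext x; simp
    rw [h2]
    exact hb.comp e.symm.bijective

theorem not_fi {G : Type u} [Group G] {P Q U : Subgroup G} (hP : P ≠ ⊥) (hQ : Q ≠ ⊥)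
    (hU : LG.CJ U (P ⊔ Q))
    (hinj : Function.Injective (Monoid.Coprod.lift P.subtype Q.subtype)) :
    ¬ FreelyIndecomposable U := by
  obtain ⟨g, hg⟩ := hU
  have hc : ∀ x ∈ P ⊔ Q, MulAut.conj g x ∈ U := fun x hx => hg ▸ ⟨x, hx, rfl⟩
  let f : P →* U := ((MulAut.conj g).toMonoidHom.comp P.subtype).codRestrict U
    fun p => hc _ (Subgroup.mem_sup_left p.2)
  let f' : Q →* U := ((MulAut.conj g).toMonoidHom.comp Q.subtype).codRestrict U
    fun p => hc _ (Subgroup.mem_sup_right p.2)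
  have : Nontrivial P := (Subgroup.nontrivial_iff_ne_bot _).2 hP
  have : Nontrivial Q := (Subgroup.nontrivial_iff_ne_bot _).2 hQ
  have key : U.subtype.comp (Monoid.Coprod.lift f f') =
      (MulAut.conj g).toMonoidHom.comp (Monoid.Coprod.lift P.subtype Q.subtype) := by
    apply Monoid.Coprod.hom_ext
    · ext x; simp [f]
    · ext x; simp [f']
  apply not_fi_gen f f'
  constructor
  · have h1 : Function.Injective (U.subtype.comp (Monoid.Coprod.lift f f')) := by
      rw [key]
      exact (MulAut.conj g).injective.comp hinj
    exact Function.Injective.of_comp (f := U.subtype) h1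
  · rintro ⟨x, hx⟩
    rw [← hg] at hx
    obtain ⟨y, hy, rfl⟩ := hx
    have : P ⊔ Q = (Monoid.Coprod.lift P.subtype Q.subtype).range := by
      rw [Monoid.Coprod.range_lift]; simp
    rw [SetLike.mem_coe, this] at hy
    obtain ⟨w, rfl⟩ := hy
    refine ⟨w, Subtype.ext ?_⟩
    exact DFunLike.congr_fun key w

namespace LG

variable {G : Type u} [Group G]

theorem inj_of_free {A : LG G} (hF : A.Free) {P Q : Subgroup G} (d : Lift A (Monoid.Coprod P Q))
    (v : A.V) (h1 : ∀ p : P, d.lg.Reach v v (p.1, Monoid.Coprod.inl p))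
    (h2 : ∀ q : Q, d.lg.Reach v v (q.1, Monoid.Coprod.inr q)) :
    Function.Injective (Monoid.Coprod.lift P.subtype Q.subtype) := by
  rw [injective_iff_map_eq_one]
  intro w hw
  have : ∀ w : Monoid.Coprod P Q, d.lg.Reach v v (Monoid.Coprod.lift P.subtype Q.subtype w, w) := by
    intro w
    induction w using Monoid.Coprod.induction_on with
    | inl p => exact (h1 p).congr (by simp)
    | inr p => exact (h2 p).congr (by simp)
    | mul x y hx hy => exact (hx.trans hy).congr (by simp)
  refine hF _ d v w ?_
  rw [← hw]
  exact this w

/-- twisted graph of a homomorphism -/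
def gr {M : Type u} [Group M] {P : Subgroup G} (k : G) (f : P →* M) : Subgroup (G × M) where
  carrier := {p | ∃ h : k * p.1 * k⁻¹ ∈ P, f ⟨_, h⟩ = p.2}
  one_mem' := ⟨by simp, by
    have : (⟨k * (1 : G × M).1 * k⁻¹, by simp⟩ : P) = 1 := Subtype.ext (by simp)
    rw [this]; simp⟩
  mul_mem' := by
    rintro ⟨a, m⟩ ⟨b, n⟩ ⟨h1, h2⟩ ⟨h3, h4⟩
    simp only at h1 h2 h3 h4
    have e : k * (a * b) * k⁻¹ = (k * a * k⁻¹) * (k * b * k⁻¹) := by group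
    refine ⟨?_, ?_⟩
    · show k * (a * b) * k⁻¹ ∈ P
      rw [e]; exact mul_mem h1 h3
    · show f ⟨k * (a * b) * k⁻¹, _⟩ = m * n
      rw [← h2, ← h4, ← map_mul]
      congr 1
      exact Subtype.ext e
  inv_mem' := by
    rintro ⟨a, m⟩ ⟨h1, h2⟩
    simp only at h1 h2
    have e : k * a⁻¹ * k⁻¹ = (k * a * k⁻¹)⁻¹ := by group
    refine ⟨?_, ?_⟩
    · show k * a⁻¹ * k⁻¹ ∈ P
      rw [e]; exact inv_mem h1
    · show f ⟨k * a⁻¹ * k⁻¹, _⟩ = m⁻¹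
      rw [← h2, ← map_inv]
      congr 1
      exact Subtype.ext e

theorem mem_gr {M : Type u} [Group M] {P : Subgroup G} {k : G} {f : P →* M} {g : G} {m : M} :
    (g, m) ∈ gr k f ↔ ∃ h : k * g * k⁻¹ ∈ P, f ⟨_, h⟩ = m := Iff.rfl

theorem gr_one {M : Type u} [Group M] {P : Subgroup G} {k : G} {f : P →* M} {m : M}
    (h : ((1 : G), m) ∈ gr k f) : m = 1 := by
  obtain ⟨h1, h2⟩ := mem_gr.1 h
  rw [← h2]
  have : (⟨k * 1 * k⁻¹, h1⟩ : P) = 1 := Subtype.ext (by simp)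
  rw [this, map_one]

open Classical in
def mergeLift (A : LG G) (η : A.E × Bool) (Q : Subgroup G)
    (hQ : ∀ g, A.hl η * g * (A.hl η)⁻¹ ∈ Q ↔ g ∈ A.H (A.ht η)) :
    Lift A (Monoid.Coprod (A.H (A.hs η)) Q) where
  K x := if x = A.hs η then gr (P := A.H (A.hs η)) 1 Monoid.Coprod.inl else
    if x = A.ht η then gr (P := Q) (A.hl η) Monoid.Coprod.inr
    else (A.H x).prod ⊥
  τ _ := 1
  sub v p hp := by
    split_ifs at hp with h1 h2
    · obtain ⟨x, _⟩ := hp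
      rw [h1]; simpa using x
    · obtain ⟨x, _⟩ := hp
      rw [h2]; exact (hQ _).1 x
    · exact hp.1
  inj v m hp := by
    split_ifs at hp with h1 h2
    · exact gr_one hp
    · exact gr_one hp
    · exact hp.2
  surj v h hh := by
    split_ifs with h1 h2
    · rw [h1] at hh
      exact ⟨_, mem_gr.2 ⟨by simpa using hh, rfl⟩⟩
    · rw [h2] at hh
      exact ⟨_, mem_gr.2 ⟨(hQ h).2 hh, rfl⟩⟩
    · exact ⟨1, hh, rfl⟩

theorem merge_inj' {A : LG G} (hF : A.Free) (η : A.E × Bool) (hne : A.hs η ≠ A.ht η) (Q : Subgroup G)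
    (hQ : ∀ g, A.hl η * g * (A.hl η)⁻¹ ∈ Q ↔ g ∈ A.H (A.ht η)) :
    Function.Injective (Monoid.Coprod.lift (A.H (A.hs η)).subtype Q.subtype) := by
  apply inj_of_free hF (A.mergeLift η Q hQ) (A.hs η)
  · intro p
    apply Reach.ofVert
    simp only [Lift.lg, mergeLift, if_true]
    refine mem_gr.2 ⟨by simp, ?_⟩
    congr 1
    exact Subtype.ext (by simp)
  · intro q
    have e1 := Reach.ofHalf (A := (A.mergeLift η Q hQ).lg) η
    have e2 : (A.mergeLift η Q hQ).lg.hl η = (A.hl η, 1) := by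
      obtain ⟨e, b⟩ := η; cases b <;> simp [hl, Lift.lg, mergeLift]
    have e3 : (A.mergeLift η Q hQ).lg.Reach (A.ht η) (A.ht η)
        ((A.hl η)⁻¹ * q.1 * A.hl η, Monoid.Coprod.inr q) := by
      apply Reach.ofVert
      simp only [Lift.lg, mergeLift, if_true, if_neg hne.symm]
      refine mem_gr.2 ⟨by simp [mul_assoc], ?_⟩
      congr 1
      exact Subtype.ext (by simp [mul_assoc])
    refine ((e1.trans e3).trans e1.symm).congr ?_
    rw [e2]
    simp [mul_assoc]

theorem merge_inj {A : LG G} (hF : A.Free) (η : A.E × Bool) (hne : A.hs η ≠ A.ht η) :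
    Function.Injective (Monoid.Coprod.lift (A.H (A.hs η)).subtype
      ((A.H (A.ht η)).map (MulAut.conj (A.hl η)).toMonoidHom).subtype) := by
  apply merge_inj' hF η hne
  intro g
  constructor
  · rintro ⟨x, hx, hxx⟩
    have : x = g := by simpa using hxx
    exact this ▸ hx
  · intro h
    exact ⟨g, h, rfl⟩

open Classical in
def loopLift (A : LG G) (f : A.E) :
    Lift A (Monoid.Coprod (A.H (A.src f)) (Subgroup.zpowers (A.lab f))) where
  K x := if x = A.src f then gr (P := A.H (A.src f)) 1 Monoid.Coprod.inl
    else (A.H x).prod ⊥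
  τ e := if e = f then Monoid.Coprod.inr ⟨A.lab f, Subgroup.mem_zpowers _⟩ else 1
  sub v p hp := by
    split_ifs at hp with h1
    · obtain ⟨x, _⟩ := hp
      rw [h1]; simpa using x
    · exact hp.1
  inj v m hp := by
    split_ifs at hp with h1
    · exact gr_one hp
    · exact hp.2
  surj v h hh := by
    split_ifs with h1
    · rw [h1] at hh
      exact ⟨_, mem_gr.2 ⟨by simpa using hh, rfl⟩⟩
    · exact ⟨1, hh, rfl⟩

theorem loop_inj {A : LG G} (hF : A.Free) (f : A.E) (hf : A.src f = A.tgt f) :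
    Function.Injective (Monoid.Coprod.lift (A.H (A.src f)).subtype
      (Subgroup.zpowers (A.lab f)).subtype) := by
  apply inj_of_free hF (A.loopLift f) (A.src f)
  · intro p
    apply Reach.ofVert
    simp only [Lift.lg, loopLift, if_true]
    refine mem_gr.2 ⟨by simp, ?_⟩
    congr 1
    exact Subtype.ext (by simp)
  · rintro ⟨_, n, rfl⟩
    have e1 := Reach.ofEdge (A := (A.loopLift f).lg) f
    have e2 : (A.loopLift f).lg.lab f =
        (A.lab f, Monoid.Coprod.inr ⟨A.lab f, Subgroup.mem_zpowers _⟩) := by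
      simp [Lift.lg, loopLift]
    rw [e2, show (A.loopLift f).lg.tgt f = A.src f from hf.symm] at e1
    have e3 : (A.lab f, Monoid.Coprod.inr ⟨A.lab f, Subgroup.mem_zpowers _⟩) ∈
      (A.loopLift f).lg.pi (A.src f) := e1
    have e4 := Subgroup.zpow_mem _ e3 n
    refine Reach.congr e4 ?_
    rw [Prod.pow_mk, ← map_zpow]
    rfl

theorem CJ.trans_conj {U H : Subgroup G} {k : G}
    (h : CJ U (H.map (MulAut.conj k).toMonoidHom)) : CJ U H := by
  obtain ⟨g, rfl⟩ := h
  refine ⟨g * k, ?_⟩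
  rw [Subgroup.map_map]
  congr 1
  ext x; simp [mul_assoc]

theorem CJ.not_zpowers {U : Subgroup G} {k : G} (hU : NonElementary U)
    (h : CJ U (Subgroup.zpowers k)) : False := by
  apply hU.2
  obtain ⟨g, rfl⟩ := h
  refine ⟨⊤, by rw [Subgroup.index_top]; exact one_ne_zero, ?_⟩
  rw [MonoidHom.map_zpowers]
  infer_instance

theorem free_conj {U : Subgroup G} (hFI : FreelyIndecomposable U) (hNE : NonElementary U) :
    ∀ (n : ℕ) (A : LG G), Fintype.card A.E = n → A.Conn → A.Free → A.Rep U →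
      ∃ v, CJ U (A.H v) := by
  intro n
  induction n with
  | zero => intro A hE hc hF hr; exact rep_noedge hr hE
  | succ n ih =>
    intro A hE hc hF hr
    by_cases hV : ∃ η, A.hs η ≠ A.ht η
    · obtain ⟨η, hne⟩ := hV
      have a2 := contract_cardE (A := A) η hne
      obtain ⟨x, hx⟩ := ih (A.contract η hne) (by omega) (contract_conn hc η hne)
        (free_contract hF η hne) (contract_rep hc hr η hne)
      simp only [contract] at hx
      split_ifs at hx with h
      · by_cases hP : A.H (A.hs η) = ⊥
        · rw [hP, bot_sup_eq] at hx
          exact ⟨_, hx.trans_conj⟩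
        by_cases hQ : (A.H (A.ht η)).map (MulAut.conj (A.hl η)).toMonoidHom = ⊥
        · rw [hQ, sup_bot_eq] at hx
          exact ⟨_, hx⟩
        exact (not_fi hP hQ hx (merge_inj hF η hne) hFI).elim
      · exact ⟨_, hx⟩
    · push Not at hV
      obtain ⟨f⟩ : Nonempty A.E := Fintype.card_pos_iff.1 (by omega)
      have hf : A.src f = A.tgt f := hV (f, true)
      have a2 := absorb_cardE (A := A) f
      obtain ⟨x, hx⟩ := ih (A.absorb f) (by omega) (absorb_conn hc f hf)
        (free_absorb hF f hf) (absorb_rep hc hr f hf)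
      simp only [absorb] at hx
      split_ifs at hx with h
      · rw [h] at hx
        by_cases hP : A.H (A.src f) = ⊥
        · rw [hP, bot_sup_eq] at hx
          exact (hx.not_zpowers hNE).elim
        by_cases hQ : Subgroup.zpowers (A.lab f) = ⊥
        · rw [hQ, sup_bot_eq] at hx
          exact ⟨_, hx⟩
        exact (not_fi hP hQ hx (loop_inj hF f hf) hFI).elim
      · exact ⟨_, hx⟩

end LG

end KWP

namespace KWP

open KW


namespace LG

variable {G : Type u} [Group G]

/-! ### Normalisation -/

def withLab (A : LG G) (f : A.E → G) : LG G where
  V := A.V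
  E := A.E
  fV := A.fV
  fE := A.fE
  H := A.H
  r := A.r
  src := A.src
  tgt := A.tgt
  lab := f

def withLabMor (A : LG G) (f : A.E → G)
    (hf : ∀ e, ∃ a ∈ A.H (A.src e), ∃ b ∈ A.H (A.tgt e), f e = a * A.lab e * b) :
    Mor A (A.withLab f) where
  ρ x := x
  γ _ := 1
  hv v h hh := by
    simp only [inv_one, one_mul, mul_one]
    exact Reach.ofVert (A := A.withLab f) hh
  he e := by
    simp only [inv_one, one_mul, mul_one]
    obtain ⟨a, ha, b, hb, h⟩ := hf e
    have h1 : (A.withLab f).Reach (A.src e) (A.src e) a⁻¹ :=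
      Reach.ofVert (A := A.withLab f) (inv_mem ha)
    have h2 : (A.withLab f).Reach (A.src e) (A.tgt e) (f e) := Reach.ofEdge (A := A.withLab f) e
    have h3 : (A.withLab f).Reach (A.tgt e) (A.tgt e) b⁻¹ :=
      Reach.ofVert (A := A.withLab f) (inv_mem hb)
    exact ((h1.trans h2).trans h3).congr (by rw [h]; group)

def withLabMor' (A : LG G) (f : A.E → G)
    (hf : ∀ e, ∃ a ∈ A.H (A.src e), ∃ b ∈ A.H (A.tgt e), f e = a * A.lab e * b) :
    Mor (A.withLab f) A where
  ρ x := x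
  γ _ := 1
  hv v h hh := by
    simp only [inv_one, one_mul, mul_one]
    exact Reach.ofVert (A := A) hh
  he e := by
    simp only [inv_one, one_mul, mul_one]
    obtain ⟨a, ha, b, hb, h⟩ := hf e
    have h1 : A.Reach (A.src e) (A.src e) a := Reach.ofVert ha
    have h3 : A.Reach (A.tgt e) (A.tgt e) b := Reach.ofVert hb
    exact ((h1.trans (Reach.ofEdge (A := A) e)).trans h3).congr h.symm

theorem exists_min_lab (A : LG G) (len : G → ℕ) (e : A.E) :
    ∃ x, (∃ a ∈ A.H (A.src e), ∃ b ∈ A.H (A.tgt e), x = a * A.lab e * b) ∧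
      ∀ a ∈ A.H (A.src e), ∀ b ∈ A.H (A.tgt e), len x ≤ len (a * A.lab e * b) := by
  classical
  have hne : {n | ∃ a ∈ A.H (A.src e), ∃ b ∈ A.H (A.tgt e), n = len (a * A.lab e * b)}.Nonempty :=
    ⟨_, 1, one_mem _, 1, one_mem _, rfl⟩
  obtain ⟨a, ha, b, hb, h⟩ := Nat.sInf_mem hne
  refine ⟨_, ⟨a, ha, b, hb, rfl⟩, fun a' ha' b' hb' => ?_⟩
  rw [← h]
  exact Nat.sInf_le ⟨a', ha', b', hb', rfl⟩

theorem normalize {A : LG G} {len : G → ℕ} {D l c : ℕ} (hG : Geo len D) {LL : Set (Subgroup G)}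
    {U : Subgroup G} (hA : A.InCl l c LL) (hr : A.Rep U) :
    ∃ A' : LG G, A'.InCl l c LL ∧ A'.Rep U ∧ A'.L len ≤ A.L len ∧
      Fintype.card A'.E = Fintype.card A.E ∧ ∀ η, Orth len (A'.H (A'.hs η)) (A'.hl η) := by
  choose f hf hmin using A.exists_min_lab len
  refine ⟨A.withLab f, ⟨?_, hA.gen, hA.mem, hA.rank, hA.cplx⟩, ?_, ?_, rfl, ?_⟩
  · intro u v
    obtain ⟨g, hg⟩ := hA.conn u v
    exact ⟨_, (A.withLabMor f hf).reach hg⟩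
  · obtain ⟨v, _⟩ := id hr
    exact rep_transfer hA.conn hr (A.withLabMor f hf) (A.withLabMor' f hf) v rfl
      (by simp [withLabMor, withLabMor'])
  · apply Finset.sum_le_sum
    intro e _
    have := hmin e 1 (one_mem _) 1 (one_mem _)
    rw [one_mul, mul_one] at this
    exact this
  · rintro ⟨e, b⟩
    obtain ⟨x, hx, y, hy, h⟩ := hf e
    cases b
    · intro k hk
      show len (f e)⁻¹ ≤ len (k * (f e)⁻¹)
      have hk' : k ∈ A.H (A.tgt e) := hk
      have := hmin e x hx (y * k⁻¹) (mul_mem hy (inv_mem hk'))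
      rw [hG.inv, ← hG.inv (k * _)]
      convert this using 2
      rw [h]; group
    · intro k hk
      show len (f e) ≤ len (k * (f e))
      have hk' : k ∈ A.H (A.src e) := hk
      have := hmin e (k * x) (mul_mem hk' hx) y hy
      convert this using 2
      rw [h]; group

/-! ### Folding -/

open Classical in
def fat (A : LG G) (η1 η2 : A.E × Bool) (η : A.E × Bool) : Option A.V :=
  if η = η1 then none else if η = η2 then none else some (A.hs η)

open Classical in
def fσ (A : LG G) (η1 η2 : A.E × Bool) (a h : G) (η : A.E × Bool) : G :=
  if η = η1 then a else if η = η2 then h⁻¹ * a else 1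

def fold (A : LG G) (η1 η2 : A.E × Bool) (a h : G) : LG G where
  V := Option A.V
  E := Option A.E
  fV := inferInstance
  fE := inferInstance
  H x := x.elim ⊥ A.H
  r x := x.elim 0 A.r
  src x := x.elim (some (A.hs η1)) fun e => A.fat η1 η2 (e, true)
  tgt x := x.elim none fun e => A.fat η1 η2 (e, false)
  lab x := x.elim a fun e => (A.fσ η1 η2 a h (e, true))⁻¹ * A.lab e * A.fσ η1 η2 a h (e, false)

theorem fold_half (A : LG G) {η1 η2 : A.E × Bool} {a h : G} (h12 : A.hs η2 = A.hs η1)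
    (hh : h ∈ A.H (A.hs η1)) (η : A.E × Bool) :
    (A.fold η1 η2 a h).Reach (some (A.hs η)) (A.fat η1 η2 η) (A.fσ η1 η2 a h η) := by
  have h0 : (A.fold η1 η2 a h).Reach (some (A.hs η1)) none a :=
    Reach.ofEdge (A := A.fold η1 η2 a h) none
  have h1 : (A.fold η1 η2 a h).Reach (some (A.hs η1)) (some (A.hs η1)) h⁻¹ :=
    Reach.ofVert (A := A.fold η1 η2 a h) (v := some (A.hs η1)) (inv_mem hh)
  unfold fat fσ
  split_ifs with c1 c2
  · rw [c1]; exact h0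
  · rw [c2, h12]; exact h1.trans h0
  · exact Reach.refl

def foldMor (A : LG G) {η1 η2 : A.E × Bool} {a h : G} (h12 : A.hs η2 = A.hs η1)
    (hh : h ∈ A.H (A.hs η1)) : Mor A (A.fold η1 η2 a h) where
  ρ := some
  γ _ := 1
  hv v k hk := by
    simp only [inv_one, one_mul, mul_one]
    exact Reach.ofVert (A := A.fold η1 η2 a h) (v := some v) hk
  he e := by
    simp only [inv_one, one_mul, mul_one]
    have h1 := A.fold_half (a := a) h12 hh (e, true)
    have h2 : (A.fold η1 η2 a h).Reach (A.fat η1 η2 (e, true)) (A.fat η1 η2 (e, false)) _ :=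
      Reach.ofEdge (A := A.fold η1 η2 a h) (some e)
    have h3 := (A.fold_half (a := a) h12 hh (e, false)).symm
    refine ((h1.trans h2).trans h3).congr ?_
    simp only [fold, Option.elim]
    group

theorem fold_half' (A : LG G) {η1 η2 : A.E × Bool} {a h : G} (h12 : A.hs η2 = A.hs η1)
    (hh : h ∈ A.H (A.hs η1)) (η : A.E × Bool) :
    A.Reach ((A.fat η1 η2 η).elim (A.hs η1) id) (A.hs η)
      ((A.fat η1 η2 η).elim a (fun _ => 1) * (A.fσ η1 η2 a h η)⁻¹) := by
  unfold fat fσ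
  split_ifs with c1 c2
  · rw [c1]; exact Reach.refl.congr (by simp)
  · rw [c2, h12]; exact (Reach.ofVert hh).congr (by simp)
  · exact Reach.refl.congr (by simp)

def foldMor' (A : LG G) {η1 η2 : A.E × Bool} {a h : G} (h12 : A.hs η2 = A.hs η1)
    (hh : h ∈ A.H (A.hs η1)) : Mor (A.fold η1 η2 a h) A where
  ρ x := x.elim (A.hs η1) id
  γ x := x.elim a (fun _ => 1)
  hv v k hk := by
    cases v with
    | none =>
      have : k = 1 := by simpa [fold] using hk
      rw [this]
      exact Reach.refl.congr (by simp)
    | some v =>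
      have : k ∈ A.H v := hk
      exact (Reach.ofVert this).congr (by simp)
  he e := by
    cases e with
    | none => exact Reach.refl.congr (by simp [fold])
    | some e =>
      have h1 := A.fold_half' (a := a) h12 hh (e, true)
      have h3 := (A.fold_half' (a := a) h12 hh (e, false)).symm
      have h2 : A.Reach (A.hs (e, true)) (A.hs (e, false)) (A.lab e) := Reach.ofEdge e
      refine ((h1.trans h2).trans h3).congr ?_
      simp only [fold, Option.elim]
      group

theorem fold_cl {A : LG G} {l c : ℕ} {LL : Set (Subgroup G)} (hA : A.InCl l c LL)
    {η1 η2 : A.E × Bool} {a h : G} (h12 : A.hs η2 = A.hs η1)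
    (hh : h ∈ A.H (A.hs η1)) : (A.fold η1 η2 a h).InCl l c LL := by
  have hE : Fintype.card (A.fold η1 η2 a h).E = Fintype.card A.E + 1 :=
    Fintype.card_option (α := A.E)
  have hV : Fintype.card (A.fold η1 η2 a h).V = Fintype.card A.V + 1 :=
    Fintype.card_option (α := A.V)
  have hsum : ∀ f : Option A.V → ℕ, f none = 0 →
      ∑ x : (A.fold η1 η2 a h).V, f x = ∑ x, f (some x) := by
    intro f hf
    have := Fintype.sum_option f
    rw [hf, zero_add] at this
    exact this
  refine ⟨?_, ?_, ?_, ?_, ?_⟩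
  · have key : ∀ x : (A.fold η1 η2 a h).V, ∃ g, (A.fold η1 η2 a h).Reach (some (A.hs η1)) x g := by
      rintro (_ | x)
      · exact ⟨_, Reach.ofEdge (A := A.fold η1 η2 a h) none⟩
      · obtain ⟨g, hg⟩ := hA.conn (A.hs η1) x
        exact ⟨_, (A.foldMor (a := a) h12 hh).reach hg⟩
    intro x y
    obtain ⟨g, hg⟩ := key x
    obtain ⟨g', hg'⟩ := key y
    exact ⟨_, hg.symm.trans hg'⟩
  · rintro (_ | x)
    · exact ⟨∅, by simp, by simp [fold]⟩
    · exact hA.gen x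
  · rintro (_ | x)
    · exact Or.inl rfl
    · exact hA.mem x
  · have h0 := hA.rank
    have h1 := hsum (A.fold η1 η2 a h).r rfl
    have h2 : ∑ x, (A.fold η1 η2 a h).r (some x) = ∑ x, A.r x := rfl
    omega
  · have h0 := hA.cplx
    have h1 := hsum (fun x => nz ((A.fold η1 η2 a h).r x)) (by simp [fold, nz])
    have h2 : ∑ x, nz ((A.fold η1 η2 a h).r (some x)) = ∑ x, nz (A.r x) := rfl
    omega

theorem fold_rep {A : LG G} {U : Subgroup G} (hc : A.Conn) (hr : A.Rep U)
    {η1 η2 : A.E × Bool} {a h : G} (h12 : A.hs η2 = A.hs η1)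
    (hh : h ∈ A.H (A.hs η1)) : (A.fold η1 η2 a h).Rep U :=
  rep_transfer hc hr (A.foldMor h12 hh) (A.foldMor' h12 hh) (A.hs η1) rfl
    (by simp [foldMor, foldMor'])

theorem fold_L {A : LG G} {len : G → ℕ} {D t D1 : ℕ} (hG : Geo len D)
    {η1 η2 : A.E × Bool} {h : G} (hne : η1 ≠ η2)
    (α : A.E × Bool → G) (m : A.E → G) (hα : ∀ η, len (α η) = t)
    (hlab : ∀ e, A.lab e = α (e, true) * m e * (α (e, false))⁻¹)
    (hlen : ∀ e, len (A.lab e) = len (m e) + 2 * t)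
    (hd : dd len (α η1) (h * α η2) ≤ D1) :
    (A.fold η1 η2 (α η1) h).L len + t ≤ A.L len + D1 := by
  classical
  let β : A.E × Bool → ℕ := fun η => if η = η1 then 0 else if η = η2 then D1 else t
  have hβ : ∀ η, len ((A.fσ η1 η2 (α η1) h η)⁻¹ * α η) ≤ β η := by
    intro η
    simp only [fσ, β]
    split_ifs with c1 c2
    · rw [c1]; simp [hG.one]
    · rw [c2]; refine le_trans (le_of_eq ?_) hd
      unfold dd; congr 1; group
    · simp [hα]
  have hsβ : ∑ η, β η + 2 * t = ∑ η : A.E × Bool, t + D1 := by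
    have e1 : ∀ f : A.E × Bool → ℕ, ∑ η, f η = f η1 + (f η2 + ∑ η ∈ (Finset.univ.erase η1).erase η2, f η) := by
      intro f
      rw [Finset.add_sum_erase _ _ (by simp [hne.symm]), Finset.add_sum_erase _ _ (by simp)]
    rw [e1 β, e1 (fun _ => t)]
    have e2 : ∑ η ∈ (Finset.univ.erase η1).erase η2, β η =
        ∑ η ∈ (Finset.univ.erase η1).erase η2, t := by
      apply Finset.sum_congr rfl
      intro η hη
      simp only [Finset.mem_erase, Finset.mem_univ, and_true] at hη
      simp [β, hη.1, hη.2]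
    rw [e2]
    simp [β, hne.symm]
    ring
  have hL : (A.fold η1 η2 (α η1) h).L len = t + ∑ e : A.E,
      len ((A.fσ η1 η2 (α η1) h (e, true))⁻¹ * A.lab e * A.fσ η1 η2 (α η1) h (e, false)) := by
    have := Fintype.sum_option (fun e : Option A.E => len ((A.fold η1 η2 (α η1) h).lab e))
    rw [← hα η1]
    exact this
  have hle : ∑ e : A.E, len ((A.fσ η1 η2 (α η1) h (e, true))⁻¹ * A.lab e *
      A.fσ η1 η2 (α η1) h (e, false)) ≤ ∑ e, (len (m e) + (β (e, true) + β (e, false))) := by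
    apply Finset.sum_le_sum
    intro e _
    have h1 := hβ (e, true)
    have h2 := hβ (e, false)
    have e1 : (A.fσ η1 η2 (α η1) h (e, true))⁻¹ * A.lab e * A.fσ η1 η2 (α η1) h (e, false) =
      ((A.fσ η1 η2 (α η1) h (e, true))⁻¹ * α (e, true)) * (m e *
        ((A.fσ η1 η2 (α η1) h (e, false))⁻¹ * α (e, false))⁻¹) := by rw [hlab]; group
    rw [e1]
    have h3 := hG.mul ((A.fσ η1 η2 (α η1) h (e, true))⁻¹ * α (e, true)) (m e *
        ((A.fσ η1 η2 (α η1) h (e, false))⁻¹ * α (e, false))⁻¹)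
    have h4 := hG.mul (m e) ((A.fσ η1 η2 (α η1) h (e, false))⁻¹ * α (e, false))⁻¹
    rw [hG.inv] at h4
    omega
  rw [Finset.sum_add_distrib] at hle
  have e3 : ∑ η, β η = ∑ e : A.E, (β (e, true) + β (e, false)) := by
    rw [Fintype.sum_prod_type]; simp
  have e4 : ∑ η : A.E × Bool, t = ∑ e : A.E, 2 * t := by
    rw [Fintype.sum_prod_type]; simp
  have e5 : A.L len = ∑ e, len (m e) + ∑ e : A.E, 2 * t := by
    rw [← Finset.sum_add_distrib]
    exact Finset.sum_congr rfl fun e _ => hlen e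
  omega

end LG

end KWP

namespace KWP

open KW


namespace LG

variable {G : Type u} [Group G]

/-- initial segments of orthogonal elements are orthogonal -/
theorem orth_init {len : G → ℕ} {D : ℕ} (hG : Geo len D) {H : Subgroup G} {a a1 a2 : G}
    (ha : Orth len H a) (e : a = a1 * a2) (hl : len a = len a1 + len a2) : Orth len H a1 := by
  intro h hh
  have h1 := ha h hh
  have h2 := hG.mul (h * a1) a2
  rw [mul_assoc, ← e] at h2
  omega

theorem exists_split {A : LG G} {len : G → ℕ} {D t : ℕ} (hG : Geo len D)
    (hlong : ∀ e, 2 * t ≤ len (A.lab e)) :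
    ∃ (α : A.E × Bool → G) (m : A.E → G), (∀ η, len (α η) = t) ∧
      (∀ e, A.lab e = α (e, true) * m e * (α (e, false))⁻¹) ∧
      (∀ e, len (A.lab e) = len (m e) + 2 * t) := by
  have : ∀ e, ∃ p m q, A.lab e = p * m * q⁻¹ ∧ len p = t ∧ len q = t ∧
      len (A.lab e) = len m + 2 * t := by
    intro e
    have h0 := hlong e
    obtain ⟨p, s, h1, h2, h3⟩ := hG.split (A.lab e) t (by omega)
    obtain ⟨m, q, h4, h5, h6⟩ := hG.split s (len s - t) (by omega)
    refine ⟨p, m, q⁻¹, ?_, h2, ?_, ?_⟩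
    · rw [h1, h4, inv_inv, mul_assoc]
    · rw [hG.inv]; omega
    · omega
  choose p m q h1 h2 h3 h4 using this
  refine ⟨fun η => bif η.2 then p η.1 else q η.1, m, ?_, ?_, h4⟩
  · rintro ⟨e, b⟩; cases b
    · exact h3 e
    · exact h2 e
  · intro e; exact h1 e

theorem split_half {A : LG G} {len : G → ℕ} {D t : ℕ} (hG : Geo len D)
    {α : A.E × Bool → G} {m : A.E → G} (hα : ∀ η, len (α η) = t)
    (hlab : ∀ e, A.lab e = α (e, true) * m e * (α (e, false))⁻¹)
    (hlen : ∀ e, len (A.lab e) = len (m e) + 2 * t) (η : A.E × Bool) :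
    ∃ a2, A.hl η = α η * a2 ∧ len (A.hl η) = t + len a2 := by
  obtain ⟨e, b⟩ := η
  have h1 := hlen e
  have key : ∀ a2, A.hl (e, b) = α (e, b) * a2 → len a2 ≤ len (m e) + t →
      len (A.hl (e, b)) = len (A.lab e) → len (A.hl (e, b)) = t + len a2 := by
    intro a2 h2 h3 h4
    have h5 := hG.mul (α (e, b)) a2
    rw [← h2, hα] at h5
    omega
  cases b
  · refine ⟨(m e)⁻¹ * (α (e, true))⁻¹, ?_, ?_⟩
    · show (A.lab e)⁻¹ = _
      rw [hlab e]; group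
    · apply key
      · show (A.lab e)⁻¹ = _
        rw [hlab e]; group
      · have := hG.mul (m e)⁻¹ (α (e, true))⁻¹
        rw [hG.inv, hG.inv, hα] at this
        exact this
      · show len (A.lab e)⁻¹ = _
        exact hG.inv _
  · refine ⟨m e * (α (e, false))⁻¹, ?_, ?_⟩
    · show A.lab e = _
      rw [hlab e]; group
    · apply key
      · show A.lab e = _
        rw [hlab e]; group
      · have := hG.mul (m e) (α (e, false))⁻¹
        rw [hG.inv, hα] at this
        exact this
      · rfl

/-- consecutive long edges make a definite angle -/
theorem angle {A : LG G} {len : G → ℕ} {D c cP B t l cc : ℕ} (hG : Geo len D)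
    {LL : Set (Subgroup G)} {U : Subgroup G} (hA : A.InCl l cc LL) (hr : A.Rep U)
    (hmin : ∀ A' : LG G, A'.InCl l cc LL → A'.Rep U → A.L len ≤ A'.L len + B)
    (horth : ∀ η, Orth len (A.H (A.hs η)) (A.hl η))
    (hqc : ∀ v, QCc len (A.H v) c)
    (hcP : ∀ v a h, Orth len (A.H v) a → h ∈ A.H v → h ≠ 1 →
      dd len a (h * a) ≤ D + 2 * c + 2 * D → len a ≤ cP)
    (ht1 : B + (D + 2 * c + 2 * D) < t) (ht2 : cP < t)
    (hlong : ∀ e, 2 * t ≤ len (A.lab e)) (η1 η2 : A.E × Bool) (h12 : A.hs η2 = A.hs η1) (h : G)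
    (hh : h ∈ A.H (A.hs η1)) (hne : η1 = η2 → h ≠ 1) :
    len h + len (A.hl η1) + len (A.hl η2) ≤
      dd len (A.hl η1) (h * A.hl η2) + ((2 * c + D) + (2 * t + (D + 2 * c))) := by
  by_cases hbig : D + 2 * c < 2 * len h
  · have o2 := horth η2
    rw [h12] at o2
    have := big_case hG (hqc _) (horth η1) o2 hh hbig
    omega
  by_contra hcon
  obtain ⟨α, m, hα, hlab, hlen⟩ := exists_split hG hlong
  obtain ⟨a2, ea, la⟩ := split_half hG hα hlab hlen η1
  obtain ⟨b2, eb, lb⟩ := split_half hG hα hlab hlen η2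
  have hcl := fold_close hG (C := D + 2 * c) (h := h) ea eb (hα η1) (hα η2) la lb (by omega) (by omega)
  by_cases h12' : η1 = η2
  · rw [← h12'] at hcl
    have ho := orth_init hG (horth η1) ea (by rw [hα]; exact la)
    have := hcP _ _ _ ho hh (hne h12') hcl
    rw [hα] at this
    omega
  · have h1 := fold_L hG h12' α m hα hlab hlen hcl
    have h2 := hmin (A.fold η1 η2 (α η1) h) (fold_cl hA h12 hh) (fold_rep hA.conn hr h12 hh)
    omega

theorem free_of_long {A : LG G} {len : G → ℕ} {D c cP B t l cc c4 c5 K : ℕ} (hG : Geo len D)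
    {LL : Set (Subgroup G)} {U : Subgroup G} (hA : A.InCl l cc LL) (hr : A.Rep U)
    (hmin : ∀ A' : LG G, A'.InCl l cc LL → A'.Rep U → A.L len ≤ A'.L len + B)
    (horth : ∀ η, Orth len (A.H (A.hs η)) (A.hl η))
    (hqc : ∀ v, QCc len (A.H v) c)
    (hcP : ∀ v a h, Orth len (A.H v) a → h ∈ A.H v → h ≠ 1 →
      dd len a (h * a) ≤ D + 2 * c + 2 * D → len a ≤ cP)
    (ht1 : B + (D + 2 * c + 2 * D) < t) (ht2 : cP < t)
    (hc4 : c4 = (2 * c + D) + (2 * t + (D + 2 * c)))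
    (hc5 : c5 = c4 + D) (hK : 4 * c5 + 4 * c4 + 4 * c + 4 * D + 4 ≤ K)
    (hlong : ∀ e, K ≤ len (A.lab e)) : A.Free := by
  have hlongη : ∀ η, K ≤ len (A.hl η) := by
    rintro ⟨e, b⟩
    cases b
    · show K ≤ len (A.lab e)⁻¹
      rw [hG.inv]; exact hlong e
    · exact hlong e
  have inv : ∀ u η g, RP A u η g →
      dd len 1 (g * (A.hl η)⁻¹) + dd len (g * (A.hl η)⁻¹) g ≤ dd len 1 g + c5 := by
    intro u η g hp
    induction hp with
    | start η h h1 hh =>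
      subst h1
      have := hqc _ _ (horth η) h⁻¹ (inv_mem hh)
      rw [inv_inv, hG.inv] at this
      rw [mul_inv_cancel_right, dd_mul, dd_one, dd_one]
      omega
    | step η η' g h _ hh hs hne ih =>
      rw [mul_inv_cancel_right]
      refine (ltg_step hG (c := c) (y := g * (A.hl η)⁻¹) (x := g) hc5 hK ?_ ?_ ih ?_ ?_).1
      · unfold dd
        rw [show (g * (A.hl η)⁻¹)⁻¹ * g = A.hl η by group]; exact hlongη η
      · rw [dd_mul]; exact hlongη η'
      · have hrs : A.hs η' = A.hs (rv η) := by rw [hs, hs_rv]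
        have hh' : h ∈ A.H (A.hs (rv η)) := by rw [hs_rv]; exact hh
        have ang := angle hG hA hr hmin horth hqc hcP ht1 ht2
          (fun e => le_trans (by omega) (hlong e)) (rv η) η' hrs h hh' (fun e => hne e.symm)
        have e1 : dd len (g * h) (g * (A.hl η)⁻¹) ≤ len h + len (A.hl (rv η)) := by
          have := hG.mul h⁻¹ (A.hl (rv η))
          rw [hG.inv] at this
          refine le_trans (le_of_eq ?_) this
          unfold dd; rw [hl_rv]; congr 1; group
        have e2 : dd len (g * (A.hl η)⁻¹) (g * h * A.hl η') =
            dd len (A.hl (rv η)) (h * A.hl η') := by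
          rw [mul_assoc, dd_left, hl_rv]
        rw [dd_mul, e2]
        omega
      · have o := horth (rv η)
        rw [hs_rv] at o
        have := hqc _ _ o h hh
        have e1 : dd len g (g * (A.hl η)⁻¹) = len (A.hl (rv η)) := by rw [dd_mul, hl_rv]
        have e2 : dd len (g * (A.hl η)⁻¹) (g * h) = len (h⁻¹ * A.hl (rv η)) := by
          rw [dd_left, dd_comm hG, hl_rv]; rfl
        rw [e1, e2, dd_mul]
        omega
  apply free_of_rp
  intro u η g h hp hh hgh
  have h1 := inv u η g hp
  have hg : g = h⁻¹ := eq_inv_of_mul_eq_one_left hgh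
  have o := horth (rv η)
  rw [hs_rv] at o
  have h2 := hqc _ _ o h hh
  have h3 := hlongη η
  have e0 : dd len (g * (A.hl η)⁻¹) g = len (A.hl η) := by
    unfold dd; rw [show (g * (A.hl η)⁻¹)⁻¹ * g = A.hl η by group]
  rw [e0, dd_one, dd_one, hg, hG.inv] at h1
  rw [hl_rv, hG.inv] at h2
  omega

end LG

end KWP

namespace KWP

open KW


namespace LG

variable {G : Type u} [Group G]

theorem unif {T : Type u} {s : Set T} (hs : s.Finite) {P : T → ℕ → Prop}
    (hmono : ∀ H m n, m ≤ n → P H m → P H n) (h : ∀ H ∈ s, ∃ n, P H n) :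
    ∃ n, ∀ H ∈ s, P H n := by
  induction s, hs using Set.Finite.induction_on with
  | empty => exact ⟨0, by simp⟩
  | @insert a s _ _ ih =>
    obtain ⟨n, hn⟩ := ih fun H hH => h H (Set.mem_insert_of_mem _ hH)
    obtain ⟨m, hm⟩ := h a (Set.mem_insert _ _)
    refine ⟨max m n, ?_⟩
    rintro H (rfl | hH)
    · exact hmono _ _ _ (le_max_left _ _) hm
    · exact hmono _ _ _ (le_max_right _ _) (hn H hH)

theorem IsGen.mono {H : Subgroup G} {r s : ℕ} (h : IsGen H r) (hrs : r ≤ s) : IsGen H s := by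
  obtain ⟨T, hT, e⟩ := h
  exact ⟨T, hT.trans hrs, e⟩

theorem mem_bot {A : LG G} {l c : ℕ} {LL : Set (Subgroup G)} (hA : A.InCl l c LL) (v : A.V) :
    A.H v ∈ insert ⊥ LL := by
  rcases hA.mem v with h | h
  · have := hA.gen v
    rw [h] at this
    exact Or.inl this.zero
  · exact Or.inr h

theorem val_le (A : LG G) (z : A.V) : A.val z ≤ 2 * Fintype.card A.E := by
  rw [← sum_val]
  exact Finset.single_le_sum (f := A.val) (fun i _ => Nat.zero_le _) (Finset.mem_univ z)

theorem consts {len : G → ℕ} {D l : ℕ} (hG : Geo len D) (hATF : AlmostTorsionFree G)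
    (hQC : ∀ H : Subgroup G, IsGen H l → ∃ c, QCc len H c) {s : Set (Subgroup G)} (hs : s.Finite) :
    ∃ c cP, ∀ H ∈ s, IsGen H l → QCc len H c ∧ ∀ a h, Orth len H a → h ∈ H → h ≠ 1 →
      dd len a (h * a) ≤ D + 2 * c + 2 * D → len a ≤ cP := by
  obtain ⟨c, hc⟩ := unif hs (P := fun H n => IsGen H l → QCc len H n) (by
    intro H m n hmn h hg k hk x hx
    have := h hg k hk x hx
    omega) (by
    intro H _
    by_cases hg : IsGen H l
    · obtain ⟨c, hc⟩ := hQC H hg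
      exact ⟨c, fun _ => hc⟩
    · exact ⟨0, fun h => absurd h hg⟩)
  obtain ⟨cP, hcP⟩ := unif hs (P := fun H n => IsGen H l → ∀ a h, Orth len H a → h ∈ H → h ≠ 1 →
      dd len a (h * a) ≤ D + 2 * c + 2 * D → len a ≤ n) (by
    intro H m n hmn h hg a x h1 h2 h3 h4
    exact (h hg a x h1 h2 h3 h4).trans hmn) (by
    intro H hH
    by_cases hg : IsGen H l
    · obtain ⟨c', hc'⟩ := propP hG hATF (hc H hH hg) (D + 2 * c + 2 * D)
      exact ⟨c', fun _ => hc'⟩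
    · exact ⟨0, fun h => absurd h hg⟩)
  exact ⟨c, cP, fun H hH hg => ⟨hc H hH hg, hcP H hH hg⟩⟩

theorem inner {len : G → ℕ} {D l c0 : ℕ} (hG : Geo len D) (hATF : AlmostTorsionFree G)
    (hQC : ∀ H : Subgroup G, IsGen H l → ∃ c, QCc len H c)
    (outerIH : ∀ LL : Set (Subgroup G), LL.Finite → ∃ F : Set (Subgroup G), F.Finite ∧
      ∀ U : Subgroup G, FreelyIndecomposable U → NonElementary U → ∀ A : LG G, A.InCl l c0 LL →
        A.Rep U → ∃ H ∈ F, CJ U H)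
    (LL : Set (Subgroup G)) (hLL : LL.Finite) :
    ∀ k B : ℕ, ∃ F : Set (Subgroup G), F.Finite ∧
      ∀ U : Subgroup G, FreelyIndecomposable U → NonElementary U → ∀ A : LG G,
        A.InCl l (c0 + 1) LL → A.Rep U → Fintype.card A.E ≤ k →
        (∀ A' : LG G, A'.InCl l (c0 + 1) LL → A'.Rep U → A.L len ≤ A'.L len + B) →
        ∃ H ∈ F, CJ U H := by
  intro k
  induction k with
  | zero =>
    intro B
    refine ⟨insert ⊥ LL, hLL.insert _, ?_⟩
    intro U _ _ A hA hr hE _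
    obtain ⟨v, hv⟩ := rep_noedge hr (Nat.le_zero.1 hE)
    exact ⟨_, mem_bot hA v, hv⟩
  | succ k ih =>
    intro B
    obtain ⟨c, cP, hcon⟩ := consts hG hATF hQC (hLL.insert ⊥)
    obtain ⟨t, ht⟩ : ∃ t, t = B + (D + 2 * c + 2 * D) + cP + 1 := ⟨_, rfl⟩
    obtain ⟨c4, hc4⟩ : ∃ c4, c4 = (2 * c + D) + (2 * t + (D + 2 * c)) := ⟨_, rfl⟩
    obtain ⟨c5, hc5⟩ : ∃ c5, c5 = c4 + D := ⟨_, rfl⟩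
    obtain ⟨K, hK⟩ : ∃ K, K = 4 * c5 + 4 * c4 + 4 * c + 4 * D + 4 := ⟨_, rfl⟩
    obtain ⟨F1, hF1, hF1'⟩ := ih (B + 2 * (k + 1) * K)
    let M : Set (Subgroup G) := (fun p : Subgroup G × Subgroup G × G =>
      p.1 ⊔ p.2.1.map (MulAut.conj p.2.2).toMonoidHom) '' (LL ×ˢ LL ×ˢ {g | len g ≤ K})
    have hM : M.Finite := (hLL.prod (hLL.prod (hG.ball K))).image _
    let M' : Set (Subgroup G) := (fun p : Subgroup G × G =>
      p.1 ⊔ Subgroup.zpowers p.2) '' ((insert ⊥ LL) ×ˢ {g | len g ≤ K})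
    have hM' : M'.Finite := ((hLL.insert _).prod (hG.ball K)).image _
    obtain ⟨F2, hF2, hF2'⟩ := outerIH (LL ∪ M ∪ M') ((hLL.union hM).union hM')
    have hsub : LL ⊆ LL ∪ M ∪ M' := fun x hx => Or.inl (Or.inl hx)
    refine ⟨insert ⊥ LL ∪ F1 ∪ F2, ((hLL.insert _).union hF1).union hF2, ?_⟩
    intro U hFI hNE A0 hA0 hr0 hE0 hmin0
    obtain ⟨A, hA, hr, hL, hE, horth⟩ := normalize hG hA0 hr0
    rw [← hE] at hE0
    have hmin : ∀ A' : LG G, A'.InCl l (c0 + 1) LL → A'.Rep U → A.L len ≤ A'.L len + B :=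
      fun A' h1 h2 => hL.trans (hmin0 A' h1 h2)
    clear hmin0 hL hE hA0 hr0
    by_cases hbig : ∃ v, l + 1 ≤ A.r v
    · obtain ⟨H, hH, hU⟩ := big_rank _ A hA hr rfl hbig
      exact ⟨H, Or.inl (Or.inl (Or.inr hH)), hU⟩
    push Not at hbig
    have hgenl : ∀ v, IsGen (A.H v) l := fun v => (hA.gen v).mono (by have := hbig v; omega)
    by_cases hlong : ∀ e, K ≤ len (A.lab e)
    · have hF := free_of_long hG hA hr hmin horth
        (fun v => (hcon _ (mem_bot hA v) (hgenl v)).1)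
        (fun v => (hcon _ (mem_bot hA v) (hgenl v)).2) (t := t) (by omega) (by omega) hc4 hc5
        (K := K) (by omega) hlong
      obtain ⟨v, hv⟩ := free_conj hFI hNE _ A rfl hA.conn hF hr
      exact ⟨_, Or.inl (Or.inl (mem_bot hA v)), hv⟩
    push Not at hlong
    obtain ⟨e, he⟩ := hlong
    by_cases hloop : A.src e = A.tgt e
    · have hcl := absorb_cl hA e hloop hsub
        (Or.inr ⟨(_, _), ⟨mem_bot hA (A.src e), he.le⟩, rfl⟩)
      obtain ⟨H, hH, hU⟩ := hF2' U hFI hNE _ hcl (absorb_rep hA.conn hr e hloop)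
      exact ⟨H, Or.inr hH, hU⟩
    have triv : ∀ η : A.E × Bool, A.hs η ≠ A.ht η → A.r (A.ht η) = 0 → len (A.hl η) ≤ K →
        ∃ H ∈ insert ⊥ LL ∪ F1 ∪ F2, CJ U H := by
      intro η hne hz hη
      have a2 := contract_cardE (A := A) η hne
      have a3 := contract_L (A := A) hG η hne
      have a4 : A.val (A.ht η) * len (A.hl η) ≤ 2 * (k + 1) * K :=
        Nat.mul_le_mul ((A.val_le _).trans (by omega)) hη
      obtain ⟨H, hH, hU⟩ := hF1' U hFI hNE _ (contract_triv hA η hne hz)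
        (contract_rep hA.conn hr η hne) (by omega) (by
          intro A' h1 h2
          have := hmin A' h1 h2
          omega)
      exact ⟨H, Or.inl (Or.inr hH), hU⟩
    by_cases hz : A.r (A.tgt e) = 0
    · exact triv (e, true) hloop hz he.le
    by_cases hz' : A.r (A.src e) = 0
    · refine triv (e, false) (fun h => hloop h.symm) hz' ?_
      show len (A.lab e)⁻¹ ≤ K
      rw [hG.inv]; exact he.le
    have m1 : A.H (A.src e) ∈ LL := (hA.mem _).resolve_left hz'
    have m2 : A.H (A.tgt e) ∈ LL := (hA.mem _).resolve_left hz
    have hcl := contract_merge hA (e, true) hloop hz hz' hsub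
      (Or.inl (Or.inr ⟨(_, _, _), ⟨m1, m2, he.le⟩, rfl⟩))
    obtain ⟨H, hH, hU⟩ := hF2' U hFI hNE _ hcl (contract_rep hA.conn hr _ _)
    exact ⟨H, Or.inr hH, hU⟩

theorem outer {len : G → ℕ} {D l : ℕ} (hG : Geo len D) (hATF : AlmostTorsionFree G)
    (hQC : ∀ H : Subgroup G, IsGen H l → ∃ c, QCc len H c) : ∀ c0 : ℕ,
    ∀ LL : Set (Subgroup G), LL.Finite → ∃ F : Set (Subgroup G), F.Finite ∧
      ∀ U : Subgroup G, FreelyIndecomposable U → NonElementary U → ∀ A : LG G, A.InCl l c0 LL →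
        A.Rep U → ∃ H ∈ F, CJ U H := by
  intro c0
  induction c0 with
  | zero =>
    intro LL _
    exact ⟨∅, Set.finite_empty, fun U _ _ A hA => (no_cl_zero hA).elim⟩
  | succ c0 ih =>
    intro LL hLL
    obtain ⟨F, hF, hF'⟩ := inner hG hATF hQC ih LL hLL (3 * (c0 + 1)) 0
    refine ⟨F, hF, fun U hFI hNE A0 hA0 hr0 => ?_⟩
    have hne : {n | ∃ A : LG G, A.InCl l (c0 + 1) LL ∧ A.Rep U ∧ n = A.L len}.Nonempty :=
      ⟨_, A0, hA0, hr0, rfl⟩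
    obtain ⟨A, hA, hr, hn⟩ := Nat.sInf_mem hne
    obtain ⟨A1, hA1, hr1, hL1, hE1⟩ := edge_bound hG _ A rfl hA hr
    refine hF' U hFI hNE A1 hA1 hr1 hE1 fun A' h1 h2 => ?_
    rw [add_zero]
    refine hL1.trans ?_
    rw [← hn]
    exact Nat.sInf_le ⟨A', h1, h2, rfl⟩

/-- a bouquet of circles -/
def rose {n : ℕ} (f : Fin n → G) : LG G where
  V := Unit
  E := Fin n
  fV := inferInstance
  fE := inferInstance
  H _ := ⊥
  r _ := 0
  src _ := ()
  tgt _ := ()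
  lab := f

theorem rose_cl {n l : ℕ} (f : Fin n → G) (hn : n ≤ l + 1) :
    (rose f).InCl l (2 * (l + 1) + 1) ∅ where
  conn _ _ := ⟨1, Reach.refl⟩
  gen _ := ⟨∅, by simp, by simp [rose]⟩
  mem _ := Or.inl rfl
  rank := by
    have h1 : Fintype.card (rose f).E = n := Fintype.card_fin n
    have h2 : Fintype.card (rose f).V = 1 := Fintype.card_unit
    have h3 : ∑ v, (rose f).r v = 0 := Finset.sum_eq_zero fun _ _ => rfl
    omega
  cplx := by
    have h1 : Fintype.card (rose f).E = n := Fintype.card_fin n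
    have h2 : Fintype.card (rose f).V = 1 := Fintype.card_unit
    have h3 : ∑ v, nz ((rose f).r v) = 0 := Finset.sum_eq_zero fun _ _ => rfl
    omega

theorem rose_rep {n : ℕ} (f : Fin n → G) : (rose f).Rep (Subgroup.closure (Set.range f)) := by
  refine ⟨(), 1, fun x => ?_⟩
  rw [inv_one, one_mul, mul_one]
  constructor
  · intro hx
    have : Subgroup.closure (Set.range f) ≤ (rose f).pi () := by
      rw [Subgroup.closure_le]
      rintro _ ⟨i, rfl⟩
      exact Reach.ofEdge (A := rose f) i
    exact this hx
  · intro hx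
    have key : ∀ (u v : (rose f).V) (x : G), (rose f).Reach u v x →
        x ∈ Subgroup.closure (Set.range f) := ?_
    · exact key _ _ _ hx
    intro u v x hx
    induction hx with
    | refl => exact one_mem _
    | @vert v g h _ hh ih =>
      have : h = (1 : G) := by simpa [rose] using hh
      rw [this, mul_one]; exact ih
    | edge η _ ih =>
      refine mul_mem ih ?_
      obtain ⟨i, b⟩ := η
      have : f i ∈ Subgroup.closure (Set.range f) := Subgroup.subset_closure ⟨i, rfl⟩
      cases b
      · exact inv_mem this
      · exact this

end LG

open LG in
theorem main {G : Type u} [Group G] (hATF : AlmostTorsionFree G) (l : ℕ)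
    {S : Finset G} {X : Type u} [MetricSpace X] [MulAction G X] {ι : G → X} {δ : ℝ} (hδ : 0 ≤ δ)
    (hS : Subgroup.closure (S : Set G) = ⊤)
    (hC : IsCayleyGraph G (S : Set G) X ι) (hX : DeltaHyperbolic δ X)
    (hq : ∀ H : Subgroup G, (∃ T : Finset G, T.card ≤ l ∧ Subgroup.closure (T : Set G) = H) →
      QCSubgroup X ι H) :
    ∃ (N : ℕ) (Hs : Fin N → Subgroup G),
      ∀ U : Subgroup G,
        (∃ T : Finset G, T.card ≤ l + 1 ∧ Subgroup.closure (T : Set G) = U) →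
        FreelyIndecomposable ↥U → NonElementary ↥U →
        ∃ (i : Fin N) (g : G), Subgroup.map (MulAut.conj g).toMonoidHom (Hs i) = U := by
  obtain ⟨D, hG⟩ := geo_of_cayley hδ hS hC hX
  obtain ⟨F, hF, hF'⟩ := outer hG hATF (l := l) (fun H hH => qc_of_qc hδ hC hX H (hq H hH))
    (2 * (l + 1) + 1) ∅ Set.finite_empty
  obtain ⟨N, Hs, hHs⟩ := hF.fin_embedding
  refine ⟨N, Hs, ?_⟩
  rintro U ⟨T, hT, rfl⟩ hFI hNE
  let f : Fin T.card → G := fun i => (T.equivFin.symm i : G)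
  have hf : Set.range f = (T : Set G) := by
    ext x
    constructor
    · rintro ⟨i, rfl⟩; exact (T.equivFin.symm i).2
    · intro hx; exact ⟨T.equivFin ⟨x, hx⟩, by simp [f]⟩
  have hr := rose_rep f
  rw [hf] at hr
  obtain ⟨H, hH, g, hg⟩ := hF' _ hFI hNE _ (rose_cl f hT) hr
  rw [← hHs] at hH
  obtain ⟨i, rfl⟩ := hH
  exact ⟨i, g, hg⟩

end KWP

namespace KW

open Pointwise Metric Set

theorem statement1 {G : Type u} [Group G] (hATF : AlmostTorsionFree G)
    (l : ℕ) (hl : 1 ≤ l)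
    (hyp : ∃ (S : Finset G) (X : Type u) (iX : MetricSpace X) (aX : MulAction G X)
        (ι : G → X) (δ : ℝ), 0 ≤ δ ∧
        Subgroup.closure (S : Set G) = ⊤ ∧
        @IsCayleyGraph G inferInstance (S : Set G) X iX aX ι ∧
        @DeltaHyperbolic δ X iX ∧
        ∀ H : Subgroup G,
          (∃ T : Finset G, T.card ≤ l ∧ Subgroup.closure (T : Set G) = H) →
          @QCSubgroup G inferInstance X iX ι H) :
    ∃ (N : ℕ) (Hs : Fin N → Subgroup G),
      ∀ U : Subgroup G,
        (∃ T : Finset G, T.card ≤ l + 1 ∧ Subgroup.closure (T : Set G) = U) →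
        FreelyIndecomposable ↥U → NonElementary ↥U →
        ∃ (i : Fin N) (g : G), Subgroup.map (MulAut.conj g).toMonoidHom (Hs i) = U := by
  obtain ⟨S, X, iX, aX, ι, δ, hδ, hS, hC, hX, hq⟩ := hyp
  exact KWP.main hATF l hδ hS hC hX hq

end KW
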